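/- arXiv:2502.05839 — 4 statements merged into one kernel-verified Lean document; each statement's English description precedes it below -/
import Mathlib

section
/- Assume μ₊ > 0 and μ₋ > 0, and that one of the following holds: (c₊ > 0 and max(a₁,a₂) ≤ a), or (c₊ > 0 and max(a₁,a₃) ≤ a < a₂), or (c₊ ≤ 0, Θ > 0 and max(a₁,a₃) ≤ a). Then g is concave on (0,a₁) and convex on (a₁,∞). -/
open Real Set Filter

/-- The exponential sum with rates `α` and `-β`, centred at `c`. -/
noncomputable def expSum (A α B β c x : ℝ) : ℝ :=
  A * exp (α * (x - c)) + B * exp (-β * (x - c))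

lemma hasDerivAt_expSum (A α B β c x : ℝ) :
    HasDerivAt (expSum A α B β c) (expSum (A * α) α (-(B * β)) β c x) x := by
  have h : ∀ k : ℝ, HasDerivAt (fun y => exp (k * (y - c))) (exp (k * (x - c)) * k) x := by
    intro k
    simpa using (((hasDerivAt_id x).sub_const c).const_mul k).exp
  refine (((h α).const_mul A).add ((h (-β)).const_mul B)).congr_deriv ?_
  simp only [expSum]
  ring

lemma expSum_eq_mul (A α B β c x : ℝ) :
    expSum A α B β c x = exp (-β * (x - c)) * (A * exp ((α + β) * (x - c)) + B) := by
  have h : exp (α * (x - c)) = exp (-β * (x - c)) * exp ((α + β) * (x - c)) := by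
    rw [← exp_add]
    ring_nf
  rw [expSum, h]
  ring

lemma expSum_nonneg {A α B β c x x₀ : ℝ} (hA : 0 ≤ A) (hαβ : 0 ≤ α + β) (hx : x₀ ≤ x)
    (h₀ : 0 ≤ A * exp ((α + β) * (x₀ - c)) + B) : 0 ≤ expSum A α B β c x := by
  rw [expSum_eq_mul]
  have : A * exp ((α + β) * (x₀ - c)) ≤ A * exp ((α + β) * (x - c)) := by gcongr
  exact mul_nonneg (exp_pos _).le (by linarith)

lemma expSum_nonpos {A α B β c x x₀ : ℝ} (hA : 0 ≤ A) (hαβ : 0 ≤ α + β) (hx : x ≤ x₀)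
    (h₀ : A * exp ((α + β) * (x₀ - c)) + B ≤ 0) : expSum A α B β c x ≤ 0 := by
  rw [expSum_eq_mul]
  have : A * exp ((α + β) * (x - c)) ≤ A * exp ((α + β) * (x₀ - c)) := by gcongr
  exact mul_nonpos_of_nonneg_of_nonpos (exp_pos _).le (by linarith)

lemma monotoneOn_Ici_expSum_deriv {A α B β c x₀ : ℝ} (hA : 0 ≤ A) (hαβ : 0 ≤ α + β)
    (h₀ : 0 ≤ A * α ^ 2 * exp ((α + β) * (x₀ - c)) + B * β ^ 2) :
    MonotoneOn (expSum (A * α) α (-(B * β)) β c) (Ici x₀) := by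
  refine monotoneOn_of_hasDerivWithinAt_nonneg (convex_Ici x₀)
    (fun x _ => (hasDerivAt_expSum ..).continuousAt.continuousWithinAt)
    (fun x _ => (hasDerivAt_expSum ..).hasDerivWithinAt) fun x hx => ?_
  rw [interior_Ici] at hx
  refine expSum_nonneg (by nlinarith [mul_nonneg hA (sq_nonneg α)]) hαβ (le_of_lt hx) ?_
  linear_combination h₀

lemma antitoneOn_Iic_expSum_deriv {A α B β c x₀ : ℝ} (hA : 0 ≤ A) (hαβ : 0 ≤ α + β)
    (h₀ : A * α ^ 2 * exp ((α + β) * (x₀ - c)) + B * β ^ 2 ≤ 0) :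
    AntitoneOn (expSum (A * α) α (-(B * β)) β c) (Iic x₀) := by
  refine antitoneOn_of_hasDerivWithinAt_nonpos (convex_Iic x₀)
    (fun x _ => (hasDerivAt_expSum ..).continuousAt.continuousWithinAt)
    (fun x _ => (hasDerivAt_expSum ..).hasDerivWithinAt) fun x hx => ?_
  rw [interior_Iic] at hx
  refine expSum_nonpos (by nlinarith [mul_nonneg hA (sq_nonneg α)]) hαβ (le_of_lt hx) ?_
  linear_combination h₀

/-- A function glued from two differentiable pieces with matching values and slopes at `a`. -/
lemma hasDerivAt_of_eqOn_Iic_Ici {f l r l' r' : ℝ → ℝ} {a : ℝ}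
    (hl : ∀ x, HasDerivAt l (l' x) x) (hr : ∀ x, HasDerivAt r (r' x) x)
    (hfl : EqOn f l (Iic a)) (hfr : EqOn f r (Ici a)) (ha : l' a = r' a) (x : ℝ) :
    HasDerivAt f (if x ≤ a then l' x else r' x) x := by
  rcases lt_trichotomy x a with h | rfl | h
  · rw [if_pos h.le]
    exact (hl x).congr_of_eventuallyEq (hfl.eventuallyEq_of_mem (Iic_mem_nhds h))
  · rw [if_pos le_rfl, ← hasDerivWithinAt_univ, ← Iic_union_Ici (a := x)]
    refine HasDerivWithinAt.union ((hl x).hasDerivWithinAt.congr hfl (hfl self_mem_Iic)) ?_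
    rw [ha]
    exact (hr x).hasDerivWithinAt.congr hfr (hfr self_mem_Ici)
  · rw [if_neg h.not_ge]
    exact (hr x).congr_of_eventuallyEq (hfr.eventuallyEq_of_mem (Ici_mem_nhds h))

/-- If the second derivative of the left piece changes sign at `b ≤ a` and that of the right piece
is nonnegative at `a`, then the `C¹` gluing at `a` is concave before `b` and convex after `b`. -/
lemma concaveOn_convexOn_of_eqOn_expSum {f : ℝ → ℝ} {A α B β C γ D δ a b : ℝ}
    (hfl : EqOn f (expSum A α B β a) (Iic a)) (hfr : EqOn f (expSum C γ D δ a) (Ici a))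
    (hslope : A * α - B * β = C * γ - D * δ) (hA : 0 ≤ A) (hC : 0 ≤ C)
    (hαβ : 0 ≤ α + β) (hγδ : 0 ≤ γ + δ) (hba : b ≤ a)
    (hleft : A * α ^ 2 * exp ((α + β) * (b - a)) + B * β ^ 2 = 0)
    (hright : 0 ≤ C * γ ^ 2 + D * δ ^ 2) :
    ConcaveOn ℝ (Iic b) f ∧ ConvexOn ℝ (Ici b) f := by
  have hslope' : expSum (A * α) α (-(B * β)) β a a = expSum (C * γ) γ (-(D * δ)) δ a a := by
    simp only [expSum, sub_self, mul_zero, exp_zero]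
    linarith
  have hd := hasDerivAt_of_eqOn_Iic_Ici (hasDerivAt_expSum A α B β a)
    (hasDerivAt_expSum C γ D δ a) hfl hfr hslope'
  have hdiff : Differentiable ℝ f := fun x => (hd x).differentiableAt
  have hl : EqOn (deriv f) (expSum (A * α) α (-(B * β)) β a) (Iic a) := fun x hx => by
    rw [(hd x).deriv, if_pos (mem_Iic.1 hx)]
  have hr : EqOn (deriv f) (expSum (C * γ) γ (-(D * δ)) δ a) (Ici a) := fun x hx => by
    rcases eq_or_lt_of_le (mem_Ici.1 hx) with rfl | h
    · rw [(hd a).deriv, if_pos le_rfl, hslope']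
    · rw [(hd x).deriv, if_neg h.not_ge]
  constructor
  · refine AntitoneOn.concaveOn_of_deriv (convex_Iic b) hdiff.continuous.continuousOn
      hdiff.differentiableOn ?_
    refine ((antitoneOn_Iic_expSum_deriv hA hαβ hleft.le).congr ?_).mono interior_subset
    exact fun x hx => (hl (le_trans hx hba)).symm
  · refine MonotoneOn.convexOn_of_deriv (convex_Ici b) hdiff.continuous.continuousOn
      hdiff.differentiableOn ?_
    have h₁ : MonotoneOn (deriv f) (Icc b a) :=
      ((monotoneOn_Ici_expSum_deriv hA hαβ hleft.ge).mono Icc_subset_Ici_self).congr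
        fun x hx => (hl hx.2).symm
    have h₂ : MonotoneOn (deriv f) (Ici a) :=
      (monotoneOn_Ici_expSum_deriv hC hγδ (by simpa using hright)).congr fun x hx => (hr hx).symm
    have h := h₁.union_right h₂ (isGreatest_Icc hba) isLeast_Ici
    rw [Icc_union_Ici_eq_Ici hba] at h
    exact h.mono interior_subset

lemma le_exp_mul_of_log_div_le {r s a : ℝ} (hs : 0 < s) (h : log r / s ≤ a) :
    r ≤ exp (s * a) := by
  rcases le_or_gt r 0 with hr | hr
  · exact hr.trans (exp_pos _).le
  · rw [← log_le_iff_le_exp hr]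
    rwa [div_le_iff₀' hs] at h

theorem statement5
    (a q μp μm σp σm : ℝ)
    (ha : 0 < a) (hq : 0 < q) (hσp : 0 < σp) (hσm : 0 < σm)
    (θ1p θ2p θ1m θ2m cm cp : ℝ)
    (hθ1p : θ1p = (Real.sqrt (μp ^ 2 + 2 * q * σp ^ 2) + μp) / σp ^ 2)
    (hθ2p : θ2p = (Real.sqrt (μp ^ 2 + 2 * q * σp ^ 2) - μp) / σp ^ 2)
    (hθ1m : θ1m = (Real.sqrt (μm ^ 2 + 2 * q * σm ^ 2) + μm) / σm ^ 2)
    (hθ2m : θ2m = (Real.sqrt (μm ^ 2 + 2 * q * σm ^ 2) - μm) / σm ^ 2)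
    (hcm : cm = (θ1m - θ1p) / (θ2m + θ1m))
    (hcp : cp = (θ2p - θ2m) / (θ2p + θ1p))
    (gm gp g : ℝ → ℝ)
    (hgm : ∀ x, gm x = if a < x then Real.exp (-θ1p * (x - a))
      else cm * Real.exp (θ2m * (x - a)) + (1 - cm) * Real.exp (-θ1m * (x - a)))
    (hgp : ∀ x, gp x = if a < x then (1 - cp) * Real.exp (θ2p * (x - a)) + cp * Real.exp (-θ1p * (x - a))
      else Real.exp (θ2m * (x - a)))
    (hg : ∀ x, g x = gp x * gm 0 - gm x * gp 0)
    (hμp : 0 < μp) (hμm : 0 < μm)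
    (Θ : ℝ)
    (hΘ : Θ = cp * θ1p ^ 2 + (1 - cp) * θ2p ^ 2)
    (a₁ : ℝ)
    (ha₁ : a₁ = 2 * Real.log (θ1m / θ2m) / (θ2m + θ1m))
    (a₂ : ℝ)
    (ha₂ : a₂ = Real.log ((θ2p + θ1m) / (θ2p - θ2m)) / (θ1m + θ2m))
    (a₃ : ℝ)
    (ha₃ : a₃ = Real.log (((1 - cm * cp) * θ1p ^ 2 - (1 - cp) * cm * θ2p ^ 2) / ((1 - cm) * Θ)) / (θ1m + θ2m))
    (hcase : (0 < cp ∧ max a₁ a₂ ≤ a) ∨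
      (0 < cp ∧ max a₁ a₃ ≤ a ∧ a < a₂) ∨
      (cp ≤ 0 ∧ 0 < Θ ∧ max a₁ a₃ ≤ a))
    :
    ConcaveOn ℝ (Set.Ioo 0 a₁) g ∧ ConvexOn ℝ (Set.Ioi a₁) g := by
  have hsqrt : ∀ m s : ℝ, 0 < s → |m| < √(m ^ 2 + 2 * q * s ^ 2) := fun m s hs => by
    rw [← sqrt_sq_eq_abs]
    exact sqrt_lt_sqrt (sq_nonneg m) (lt_add_of_pos_right _ (by positivity))
  have hp := abs_lt.1 (hsqrt μp σp hσp)
  have hm := abs_lt.1 (hsqrt μm σm hσm)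
  have h1p : 0 < θ1p := hθ1p ▸ div_pos (by linarith) (by positivity)
  have h2p : 0 < θ2p := hθ2p ▸ div_pos (by linarith) (by positivity)
  have h1m : 0 < θ1m := hθ1m ▸ div_pos (by linarith) (by positivity)
  have h2m : 0 < θ2m := hθ2m ▸ div_pos (by linarith) (by positivity)
  clear hθ1p hθ2p hθ1m hθ2m hsqrt hp hm
  have hsm : 0 < θ1m + θ2m := by linarith
  have hsp : 0 < θ2p + θ1p := by linarith
  have ha₁a : a₁ ≤ a := by
    rcases hcase with h | h | h
    · exact (le_max_left _ _).trans h.2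
    · exact (le_max_left _ _).trans h.2.1
    · exact (le_max_left _ _).trans h.2.2
  have hcm_mul : cm * (θ2m + θ1m) = θ1m - θ1p := by
    rw [hcm]
    field_simp
  have hcp_mul : cp * (θ2p + θ1p) = θ2p - θ2m := by
    rw [hcp]
    field_simp
  have hcm1 : 0 < 1 - cm := by
    have : (1 - cm) * (θ2m + θ1m) = θ2m + θ1p := by linear_combination -hcm_mul
    exact pos_of_mul_pos_left (by rw [this]; positivity) (by positivity)
  have hcp1 : 0 < 1 - cp := by
    have : (1 - cp) * (θ2p + θ1p) = θ1p + θ2m := by linear_combination -hcp_mul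
    exact pos_of_mul_pos_left (by rw [this]; positivity) (by positivity)
  set E := exp ((θ1m + θ2m) * a) with hE
  set e := exp (-θ2m * a) with he
  have he_pos : 0 < e := exp_pos _
  have hE1 : 1 ≤ E := one_le_exp (by positivity)
  have hgp0 : gp 0 = e := by
    rw [hgp, if_neg ha.not_gt, he]
    ring_nf
  have hgm0 : gm 0 = e * (cm + (1 - cm) * E) := by
    have h : exp (-θ1m * (0 - a)) = e * E := by
      rw [hE, he, ← exp_add]
      ring_nf
    have h' : exp (θ2m * (0 - a)) = e := by
      rw [he]
      ring_nf
    rw [hgm, if_neg ha.not_gt, h, h']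
    ring
  have hgm0_pos : 0 < gm 0 := by
    rw [hgm0]
    have := mul_le_mul_of_nonneg_left hE1 hcm1.le
    exact mul_pos he_pos (by linarith)
  have hfl : EqOn g (expSum (e * ((1 - cm) * E)) θ2m (-(e * (1 - cm))) θ1m a) (Iic a) :=
    fun x hx => by
      rw [hg, hgp0, hgm0, hgp, hgm, if_neg (not_lt.2 hx), if_neg (not_lt.2 hx), expSum]
      ring
  have hfr : EqOn g (expSum (gm 0 * (1 - cp)) θ2p (gm 0 * cp - e) θ1p a) (Ici a) :=
    fun x hx => by
      rcases eq_or_lt_of_le (mem_Ici.1 hx) with rfl | h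
      · rw [hg, hgp0, hgp a, hgm a, if_neg (lt_irrefl _), if_neg (lt_irrefl _), expSum]
        simp only [sub_self, mul_zero, exp_zero]
        ring
      · rw [hg, hgp0, hgp x, hgm x, if_pos h, if_pos h, expSum]
        ring
  have hleft : e * ((1 - cm) * E) * θ2m ^ 2 * exp ((θ2m + θ1m) * (a₁ - a))
      + -(e * (1 - cm)) * θ1m ^ 2 = 0 := by
    have h : E * exp ((θ2m + θ1m) * (a₁ - a)) = (θ1m / θ2m) ^ 2 := by
      rw [hE, ← exp_add, show (θ1m + θ2m) * a + (θ2m + θ1m) * (a₁ - a)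
        = log (θ1m / θ2m) + log (θ1m / θ2m) by rw [ha₁]; field_simp; ring, exp_add,
        exp_log (div_pos h1m h2m), sq]
    have h' : (θ1m / θ2m) ^ 2 * θ2m ^ 2 = θ1m ^ 2 := by field_simp
    linear_combination e * (1 - cm) * θ2m ^ 2 * h + e * (1 - cm) * h'
  have hright : 0 ≤ gm 0 * (1 - cp) * θ2p ^ 2 + (gm 0 * cp - e) * θ1p ^ 2 := by
    have of_a₃ : 0 < Θ → a₃ ≤ a →
        0 ≤ gm 0 * (1 - cp) * θ2p ^ 2 + (gm 0 * cp - e) * θ1p ^ 2 := fun hΘ_pos h => by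
      have h := le_exp_mul_of_log_div_le hsm (ha₃ ▸ h)
      rw [← hE, div_le_iff₀' (by positivity)] at h
      have := mul_nonneg he_pos.le (sub_nonneg.2 h)
      rw [hgm0]
      rw [hΘ] at this
      linear_combination this
    rcases hcase with ⟨hcp0, h⟩ | ⟨hcp0, h, -⟩ | ⟨-, hΘ_pos, h⟩
    · have hpos : 0 < θ2p - θ2m := hcp_mul ▸ by positivity
      have h := le_exp_mul_of_log_div_le hsm (ha₂ ▸ (le_max_right _ _).trans h)
      rw [← hE, div_le_iff₀' hpos] at h
      have hD : 0 ≤ gm 0 * cp - e := by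
        have key : (gm 0 * cp - e) * ((θ2p + θ1p) * (θ2m + θ1m))
            = e * (θ2m + θ1p) * ((θ2p - θ2m) * E - (θ2p + θ1m)) := by
          rw [hgm0, hcm, hcp]
          field_simp
          ring
        refine nonneg_of_mul_nonneg_left (b := (θ2p + θ1p) * (θ2m + θ1m)) ?_ (by positivity)
        rw [key]
        exact mul_nonneg (by positivity) (sub_nonneg.2 h)
      positivity
    · exact of_a₃ (hΘ ▸ by positivity) ((le_max_right _ _).trans h)
    · exact of_a₃ hΘ_pos ((le_max_right _ _).trans h)
  have hslope : e * ((1 - cm) * E) * θ2m - -(e * (1 - cm)) * θ1m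
      = gm 0 * (1 - cp) * θ2p - (gm 0 * cp - e) * θ1p := by
    rw [hgm0]
    linear_combination e * (cm + (1 - cm) * E) * hcp_mul - e * hcm_mul
  have := concaveOn_convexOn_of_eqOn_expSum hfl hfr hslope (by positivity) (by positivity)
    (by positivity) (by positivity) ha₁a hleft hright
  exact ⟨this.1.subset (Ioo_subset_Iio_self.trans Iio_subset_Iic_self) (convex_Ioo _ _),
    this.2.subset Ioi_subset_Ici_self (convex_Ioi _)⟩
end

section
/- Assume μ₊ > 0 and μ₋ > 0, and that one of the following holds: (c₊ > 0 and a₁ < a < min(a₂,a₃)), or (c₊ ≤ 0, Θ ≤ 0 and a₁ < a), or (c₊ ≤ 0, Θ > 0 and a₁ < a < a₃). Then g is concave on (0,a₁), convex on (a₁,a), concave on (a,x₀), and convex on (x₀,∞). -/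
open Real Set Filter

/-- A combination of two exponentials is convex where its second derivative is nonnegative. -/
theorem convexOn_add_exp {D : Set ℝ} (hD : Convex ℝ D) (hDo : IsOpen D) {A B α β s : ℝ}
    (h : ∀ x ∈ D, 0 ≤ A * α ^ 2 * exp (α * (x - s)) + B * β ^ 2 * exp (-β * (x - s))) :
    ConvexOn ℝ D (fun x => A * exp (α * (x - s)) + B * exp (-β * (x - s))) := by
  have key : ∀ (c k x : ℝ),
      HasDerivAt (fun x => c * exp (k * (x - s))) (c * k * exp (k * (x - s))) x := by
    intro c k x
    have h1 : HasDerivAt (fun x => k * (x - s)) (k * 1) x :=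
      ((hasDerivAt_id x).sub_const s).const_mul k
    exact (h1.exp.const_mul c).congr_deriv (by ring)
  refine convexOn_of_hasDerivWithinAt2_nonneg hD (fun x _ => ?_)
    (f' := fun x => A * α * exp (α * (x - s)) + B * (-β) * exp (-β * (x - s)))
    (f'' := fun x => A * α * α * exp (α * (x - s)) + B * (-β) * (-β) * exp (-β * (x - s)))
    (fun x _ => ?_) (fun x _ => ?_) (fun x hx => ?_)
  · exact ((key A α x).add (key B (-β) x)).continuousAt.continuousWithinAt
  · exact ((key A α x).add (key B (-β) x)).hasDerivWithinAt
  · exact ((key (A * α) α x).add (key (B * (-β)) (-β) x)).hasDerivWithinAt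
  · rw [hDo.interior_eq] at hx
    have := h x hx
    linarith

theorem exp_mul_le_of_le_inflection {A B α β y : ℝ} (hA : 0 < A) (hB : 0 < B) (hα : 0 < α)
    (hβ : 0 < β) (hy : y ≤ log (B * β ^ 2 / (A * α ^ 2)) / (α + β)) :
    A * α ^ 2 * exp (α * y) ≤ B * β ^ 2 * exp (-β * y) := by
  rw [le_div_iff₀ (by positivity), le_log_iff_exp_le (by positivity),
    le_div_iff₀ (by positivity)] at hy
  have e : exp (α * y) = exp (y * (α + β)) * exp (-β * y) := by
    rw [← exp_add]; congr 1; ring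
  rw [e]
  nlinarith [mul_le_mul_of_nonneg_right hy (exp_pos (-β * y)).le]

theorem exp_mul_le_of_inflection_le {A B α β y : ℝ} (hA : 0 < A) (hB : 0 < B) (hα : 0 < α)
    (hβ : 0 < β) (hy : log (B * β ^ 2 / (A * α ^ 2)) / (α + β) ≤ y) :
    B * β ^ 2 * exp (-β * y) ≤ A * α ^ 2 * exp (α * y) := by
  rw [div_le_iff₀ (by positivity), log_le_iff_le_exp (by positivity),
    div_le_iff₀ (by positivity)] at hy
  have e : exp (α * y) = exp (y * (α + β)) * exp (-β * y) := by
    rw [← exp_add]; congr 1; ring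
  rw [e]
  nlinarith [mul_le_mul_of_nonneg_right hy (exp_pos (-β * y)).le]

/-- `A * exp (α * (x - s)) - B * exp (-β * (x - s))` is convex to the right of its inflection
point. -/
theorem convexOn_of_inflection_le {D : Set ℝ} (hD : Convex ℝ D) (hDo : IsOpen D) {f : ℝ → ℝ}
    {A B α β s : ℝ} (hA : 0 < A) (hB : 0 < B) (hα : 0 < α) (hβ : 0 < β)
    (hf : ∀ x ∈ D, f x = A * exp (α * (x - s)) - B * exp (-β * (x - s)))
    (ht : ∀ x ∈ D, s + log (B * β ^ 2 / (A * α ^ 2)) / (α + β) ≤ x) : ConvexOn ℝ D f := by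
  refine (convexOn_add_exp (A := A) (B := -B) (α := α) (β := β) (s := s) hD hDo
    fun x hx => ?_).congr fun x hx => ?_
  · have := exp_mul_le_of_inflection_le hA hB hα hβ (le_sub_iff_add_le'.2 (ht x hx))
    linarith
  · simp only [hf x hx]; ring

/-- `A * exp (α * (x - s)) - B * exp (-β * (x - s))` is concave to the left of its inflection
point. -/
theorem concaveOn_of_le_inflection {D : Set ℝ} (hD : Convex ℝ D) (hDo : IsOpen D) {f : ℝ → ℝ}
    {A B α β s : ℝ} (hA : 0 < A) (hB : 0 < B) (hα : 0 < α) (hβ : 0 < β)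
    (hf : ∀ x ∈ D, f x = A * exp (α * (x - s)) - B * exp (-β * (x - s)))
    (ht : ∀ x ∈ D, x ≤ s + log (B * β ^ 2 / (A * α ^ 2)) / (α + β)) : ConcaveOn ℝ D f := by
  refine (neg_convexOn_iff).1 <| (convexOn_add_exp (A := -A) (B := B) (α := α) (β := β) (s := s)
    hD hDo fun x hx => ?_).congr fun x hx => ?_
  · have := exp_mul_le_of_le_inflection hA hB hα hβ (sub_le_iff_le_add'.2 (ht x hx))
    linarith
  · simp only [Pi.neg_apply, hf x hx]; ring

theorem abs_lt_sqrt_sq_add {μ q σ : ℝ} (hq : 0 < q) (hσ : 0 < σ) :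
    |μ| < √(μ ^ 2 + 2 * q * σ ^ 2) := by
  rw [← sqrt_sq_eq_abs]
  exact sqrt_lt_sqrt (sq_nonneg μ) (by nlinarith [mul_pos hq (pow_pos hσ 2)])

theorem div_mul_add_lt_one {P Q M N E : ℝ} (hQP : 0 < Q + P) (hNM : 0 < N + M) (hNP : 0 < N + P)
    (h : E * (Q - N) < Q + M) :
    (Q - N) / (Q + P) * ((M - P) / (N + M) + (N + P) / (N + M) * E) < 1 := by
  have e : (Q - N) / (Q + P) * ((M - P) / (N + M) + (N + P) / (N + M) * E) =
      ((Q - N) * (M - P) + (N + P) * (E * (Q - N))) / ((Q + P) * (N + M)) := by field_simp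
  rw [e, div_lt_one (by positivity)]
  linarith [mul_lt_mul_of_pos_left h hNP]

theorem statement6
    (a q μp μm σp σm : ℝ)
    (ha : 0 < a) (hq : 0 < q) (hσp : 0 < σp) (hσm : 0 < σm)
    (θ1p θ2p θ1m θ2m cm cp : ℝ)
    (hθ1p : θ1p = (Real.sqrt (μp ^ 2 + 2 * q * σp ^ 2) + μp) / σp ^ 2)
    (hθ2p : θ2p = (Real.sqrt (μp ^ 2 + 2 * q * σp ^ 2) - μp) / σp ^ 2)
    (hθ1m : θ1m = (Real.sqrt (μm ^ 2 + 2 * q * σm ^ 2) + μm) / σm ^ 2)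
    (hθ2m : θ2m = (Real.sqrt (μm ^ 2 + 2 * q * σm ^ 2) - μm) / σm ^ 2)
    (hcm : cm = (θ1m - θ1p) / (θ2m + θ1m))
    (hcp : cp = (θ2p - θ2m) / (θ2p + θ1p))
    (gm gp g : ℝ → ℝ)
    (hgm : ∀ x, gm x = if a < x then Real.exp (-θ1p * (x - a))
      else cm * Real.exp (θ2m * (x - a)) + (1 - cm) * Real.exp (-θ1m * (x - a)))
    (hgp : ∀ x, gp x = if a < x then (1 - cp) * Real.exp (θ2p * (x - a)) + cp * Real.exp (-θ1p * (x - a))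
      else Real.exp (θ2m * (x - a)))
    (hg : ∀ x, g x = gp x * gm 0 - gm x * gp 0)
    (hμp : 0 < μp) (hμm : 0 < μm)
    (Θ : ℝ)
    (hΘ : Θ = cp * θ1p ^ 2 + (1 - cp) * θ2p ^ 2)
    (x₀ : ℝ)
    (hx₀ : x₀ = a + Real.log ((gp 0 - cp * gm 0) * θ1p ^ 2 / ((1 - cp) * gm 0 * θ2p ^ 2)) / (θ2p + θ1p))
    (a₁ : ℝ)
    (ha₁ : a₁ = 2 * Real.log (θ1m / θ2m) / (θ2m + θ1m))
    (a₂ : ℝ)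
    (ha₂ : a₂ = Real.log ((θ2p + θ1m) / (θ2p - θ2m)) / (θ1m + θ2m))
    (a₃ : ℝ)
    (ha₃ : a₃ = Real.log (((1 - cm * cp) * θ1p ^ 2 - (1 - cp) * cm * θ2p ^ 2) / ((1 - cm) * Θ)) / (θ1m + θ2m))
    (hcase : (0 < cp ∧ a₁ < a ∧ a < min a₂ a₃) ∨
      (cp ≤ 0 ∧ Θ ≤ 0 ∧ a₁ < a) ∨
      (cp ≤ 0 ∧ 0 < Θ ∧ a₁ < a ∧ a < a₃))
    :
    ConcaveOn ℝ (Set.Ioo 0 a₁) g ∧ ConvexOn ℝ (Set.Ioo a₁ a) g ∧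
      ConcaveOn ℝ (Set.Ioo a x₀) g ∧ ConvexOn ℝ (Set.Ioi x₀) g := by
  have hsp := abs_lt.1 (abs_lt_sqrt_sq_add (μ := μp) hq hσp)
  have hsm := abs_lt.1 (abs_lt_sqrt_sq_add (μ := μm) hq hσm)
  have hP : 0 < θ1p := by rw [hθ1p]; exact div_pos (by linarith) (by positivity)
  have hQ : 0 < θ2p := by rw [hθ2p]; exact div_pos (by linarith) (by positivity)
  have hM : 0 < θ1m := by rw [hθ1m]; exact div_pos (by linarith) (by positivity)
  have hN : 0 < θ2m := by rw [hθ2m]; exact div_pos (by linarith) (by positivity)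
  have hQP : θ2p ≤ θ1p := by rw [hθ1p, hθ2p]; gcongr; linarith
  clear hθ1p hθ2p hθ1m hθ2m hsp hsm
  have hcm1 : 1 - cm = (θ2m + θ1p) / (θ2m + θ1m) := by rw [hcm]; field_simp; ring
  have hcp1 : 1 - cp = (θ1p + θ2m) / (θ2p + θ1p) := by rw [hcp]; field_simp; ring
  have hcm0 : 0 < 1 - cm := by rw [hcm1]; positivity
  have hcp0 : 0 < 1 - cp := by rw [hcp1]; positivity
  have hgp0 : gp 0 = exp (-θ2m * a) := by
    rw [hgp, if_neg ha.le.not_gt]; congr 1; ring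
  set E := exp ((θ1m + θ2m) * a) with hE
  have hE1 : 1 < E := one_lt_exp_iff.2 (by positivity)
  have hgm0 : gm 0 = gp 0 * (cm + (1 - cm) * E) := by
    rw [hgm, if_neg ha.le.not_gt, hgp0, hE, mul_add, mul_left_comm _ (1 - cm), ← exp_add]
    ring_nf
  have hgp_pos : 0 < gp 0 := hgp0 ▸ exp_pos _
  have hgm_pos : 0 < gm 0 := by
    rw [hgm0]; exact mul_pos hgp_pos (by linarith [mul_pos hcm0 (sub_pos.2 hE1)])
  have hΘle : Θ ≤ θ1p ^ 2 := by
    rw [hΘ]; linarith [mul_nonneg hcp0.le (sub_nonneg.2 (pow_le_pow_left₀ hQ.le hQP 2))]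
  have hB : 0 < gp 0 - cp * gm 0 := by
    have hcase' : cp ≤ 0 ∨ (0 < cp ∧ a < a₂) := by
      rcases hcase with ⟨h, _, h'⟩ | ⟨h, _⟩ | ⟨h, _⟩
      · exact Or.inr ⟨h, h'.trans_le (min_le_left _ _)⟩
      · exact Or.inl h
      · exact Or.inl h
    rcases hcase' with h | ⟨h, h₂⟩
    · linarith [mul_nonneg (neg_nonneg.2 h) hgm_pos.le]
    · have hQN : 0 < θ2p - θ2m := by
        rw [hcp] at h
        exact (div_pos_iff_of_pos_right (by positivity)).1 h
      rw [ha₂, lt_div_iff₀ (by positivity), lt_log_iff_exp_lt (by positivity), mul_comm a, ← hE,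
        lt_div_iff₀ hQN] at h₂
      have : cp * (cm + (1 - cm) * E) < 1 := by
        rw [hcm1, hcm, hcp]
        exact div_mul_add_lt_one (by positivity) (by positivity) (by positivity) h₂
      rw [hgm0]
      linarith [mul_pos hgp_pos (sub_pos.2 this)]
  have hΘgm : Θ * gm 0 ≤ gp 0 * θ1p ^ 2 := by
    have hcase' : Θ ≤ 0 ∨ (0 < Θ ∧ a < a₃) := by
      rcases hcase with ⟨h, _, h'⟩ | ⟨_, h, _⟩ | ⟨_, h, _, h'⟩
      · refine Or.inr ⟨?_, h'.trans_le (min_le_right _ _)⟩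
        rw [hΘ]; positivity
      · exact Or.inl h
      · exact Or.inr ⟨h, h'⟩
    rcases hcase' with h | ⟨h, h₃⟩
    · exact (mul_nonpos_of_nonpos_of_nonneg h hgm_pos.le).trans (by positivity)
    · have hnum : (1 - cm * cp) * θ1p ^ 2 - (1 - cp) * cm * θ2p ^ 2 = θ1p ^ 2 - cm * Θ := by
        rw [hΘ]; ring
      have hnum_pos : 0 < θ1p ^ 2 - cm * Θ := by linarith [mul_pos hcm0 h]
      rw [ha₃, hnum, lt_div_iff₀ (by positivity), lt_log_iff_exp_lt (by positivity), mul_comm a,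
        ← hE, lt_div_iff₀ (by positivity)] at h₃
      rw [hgm0]
      linarith [mul_lt_mul_of_pos_left h₃ hgp_pos]
  have hgle : ∀ x ≤ a, g x = (1 - cm) * gp 0 * exp (θ1m * a) * exp (θ2m * (x - 0)) -
      (1 - cm) * gp 0 * exp (θ1m * a) * exp (-θ1m * (x - 0)) := by
    intro x hx
    have hEm : exp (θ1m * a) = E * exp (-θ2m * a) := by
      rw [hE, ← exp_add]; ring_nf
    rw [hg, hgp x, hgm x, if_neg hx.not_gt, if_neg hx.not_gt, hgm0,
      show θ2m * (x - a) = θ2m * (x - 0) + -θ2m * a by ring,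
      show -θ1m * (x - a) = -θ1m * (x - 0) + θ1m * a by ring, exp_add, exp_add, hEm]
    ring
  have hggt : ∀ x, a < x → g x = (1 - cp) * gm 0 * exp (θ2p * (x - a)) -
      (gp 0 - cp * gm 0) * exp (-θ1p * (x - a)) := by
    intro x hx
    rw [hg, hgp x, hgm x, if_pos hx, if_pos hx]
    ring
  have hK : 0 < (1 - cm) * gp 0 * exp (θ1m * a) := by positivity
  have ha₁' : a₁ = 0 + log ((1 - cm) * gp 0 * exp (θ1m * a) * θ1m ^ 2 /
      ((1 - cm) * gp 0 * exp (θ1m * a) * θ2m ^ 2)) / (θ2m + θ1m) := by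
    rw [mul_div_mul_left _ _ hK.ne', ← div_pow, log_pow, ha₁, zero_add]
    norm_num
  have hA : 0 < (1 - cp) * gm 0 := mul_pos hcp0 hgm_pos
  have ha₁a : a₁ < a := by
    rcases hcase with ⟨_, h, _⟩ | ⟨_, _, h⟩ | ⟨_, _, h, _⟩ <;> exact h
  have hax₀ : a ≤ x₀ := by
    rw [hx₀, le_add_iff_nonneg_right]
    refine div_nonneg (log_nonneg ?_) (by positivity)
    rw [one_le_div (by positivity)]
    rw [hΘ] at hΘgm
    linarith
  refine ⟨concaveOn_of_le_inflection (convex_Ioo _ _) isOpen_Ioo hK hK hN hM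
      (fun x hx => hgle x (hx.2.trans ha₁a).le) fun x hx => ha₁' ▸ hx.2.le,
    convexOn_of_inflection_le (convex_Ioo _ _) isOpen_Ioo hK hK hN hM
      (fun x hx => hgle x hx.2.le) fun x hx => ha₁' ▸ hx.1.le,
    concaveOn_of_le_inflection (convex_Ioo _ _) isOpen_Ioo hA hB hQ hP
      (fun x hx => hggt x hx.1) fun x hx => hx₀ ▸ hx.2.le,
    convexOn_of_inflection_le (convex_Ioi _) isOpen_Ioi hA hB hQ hP
      (fun x hx => hggt x (hax₀.trans_lt hx)) fun x hx => hx₀ ▸ (le_of_lt hx)⟩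
end

section
/- Assume μ₊ > 0, μ₋ > 0, and that one of the following holds: (c₊ > 0 and max(a₁,a₂) ≤ a), or (c₊ > 0 and max(a₁,a₃) ≤ a < a₂), or (c₊ ≤ 0, Θ > 0 and max(a₁,a₃) ≤ a). Define ι̃(u) := inf{z ∈ [0,a₁] : g'(z) ≤ u} and φ̃(x) := ψ(ι̃(g'(x)), x) for x ≥ a₁. Then there exists a unique z₂ ∈ (a₁,∞) with φ̃(z₂) = β, and M_ζ = {(ι̃(g'(z₂)), z₂)}. -/
open Real Set Filter

/-- Two differentiable functions agreeing to first order at `a` glue to a differentiable function. -/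
theorem hasDerivAt_ite_lt {f₁ f₂ f₁' f₂' : ℝ → ℝ} {a : ℝ}
    (h₁ : ∀ x, HasDerivAt f₁ (f₁' x) x) (h₂ : ∀ x, HasDerivAt f₂ (f₂' x) x)
    (h : f₁ a = f₂ a) (h' : f₁' a = f₂' a) (x : ℝ) :
    HasDerivAt (fun y => if a < y then f₂ y else f₁ y) (if a < x then f₂' x else f₁' x) x := by
  rcases lt_trichotomy a x with hx | rfl | hx
  · rw [if_pos hx]
    refine (h₂ x).congr_of_eventuallyEq ?_
    filter_upwards [Ioi_mem_nhds hx] with y hy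
    exact if_pos hy
  · rw [if_neg (lt_irrefl a)]
    have hl : HasDerivWithinAt (fun y => if a < y then f₂ y else f₁ y) (f₁' a) (Iic a) a :=
      (h₁ a).hasDerivWithinAt.congr (fun y hy => if_neg (not_lt.2 hy)) (if_neg (lt_irrefl a))
    have hr : HasDerivWithinAt (fun y => if a < y then f₂ y else f₁ y) (f₁' a) (Ici a) a := by
      rw [h']
      refine (h₂ a).hasDerivWithinAt.congr (fun y hy => ?_) (by simp [h])
      rcases (mem_Ici.1 hy).eq_or_lt with rfl | hy
      · simp [h]
      · exact if_pos hy
    have := hl.union hr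
    rwa [Iic_union_Ici, hasDerivWithinAt_univ] at this
  · rw [if_neg hx.le.not_gt]
    refine (h₁ x).congr_of_eventuallyEq ?_
    filter_upwards [Iio_mem_nhds hx] with y hy
    exact if_neg (not_lt.2 (le_of_lt hy))

theorem isLeast_sInf_sublevel {h : ℝ → ℝ} (hc : Continuous h) {a₁ u : ℝ} (ha₁ : 0 ≤ a₁)
    (hu : h a₁ ≤ u) :
    IsLeast {z : ℝ | z ∈ Icc 0 a₁ ∧ h z ≤ u} (sInf {z : ℝ | z ∈ Icc 0 a₁ ∧ h z ≤ u}) := by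
  have hK : IsCompact {z : ℝ | z ∈ Icc 0 a₁ ∧ h z ≤ u} :=
    isCompact_Icc.inter_right (isClosed_le hc continuous_const)
  exact hK.isLeast_sInf ⟨a₁, ⟨ha₁, le_rfl⟩, hu⟩

/-- If `h = g'` decreases on `[0, a₁]` and increases on `[a₁, ∞)`, then for `y > a₁` the increments
of `s ↦ s - g s / h y` over intervals in `[0, ∞)` are maximal exactly on `[i, y]`, where `i` is the
least point of `[0, a₁]` with `h i ≤ h y`. -/
theorem increment_le_of_isLeast {g h : ℝ → ℝ} {a₁ y i : ℝ} (hd : ∀ x, HasDerivAt g (h x) x)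
    (hpos : ∀ x, 0 < h x) (hanti : StrictAntiOn h (Icc 0 a₁)) (hmono : StrictMonoOn h (Ici a₁))
    (hy : a₁ < y) (hi : IsLeast {z : ℝ | z ∈ Icc 0 a₁ ∧ h z ≤ h y} i) {x' y' : ℝ} (hx' : 0 ≤ x')
    (hxy : x' ≤ y') :
    (y' - x') - (g y' - g x') / h y ≤ (y - i) - (g y - g i) / h y ∧
      ((y' - x') - (g y' - g x') / h y = (y - i) - (g y - g i) / h y → x' = i ∧ y' = y) := by
  obtain ⟨⟨⟨hi0, hi1⟩, hiu⟩, hlow⟩ := hi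
  have hu := hpos y
  set w : ℝ → ℝ := fun s => s - g s / h y with hw
  have hwd : ∀ s, HasDerivAt w (1 - h s / h y) s := fun s =>
    (hasDerivAt_id s).sub ((hd s).div_const _)
  have hwc : Continuous w := continuous_iff_continuousAt.2 fun s => (hwd s).continuousAt
  have hA : StrictAntiOn w (Icc 0 i) := by
    refine strictAntiOn_of_deriv_neg (convex_Icc _ _) hwc.continuousOn fun s hs => ?_
    rw [interior_Icc] at hs
    rw [(hwd s).deriv, sub_neg, one_lt_div hu]
    by_contra! hcon
    exact absurd (hlow ⟨⟨hs.1.le, hs.2.le.trans hi1⟩, hcon⟩) (not_le.2 hs.2)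
  have hB : StrictMonoOn w (Icc i y) := by
    refine strictMonoOn_of_deriv_pos (convex_Icc _ _) hwc.continuousOn fun s hs => ?_
    rw [interior_Icc] at hs
    rw [(hwd s).deriv, sub_pos, div_lt_one hu]
    rcases le_total s a₁ with hs1 | hs1
    · exact (hanti ⟨hi0, hi1⟩ ⟨hi0.trans hs.1.le, hs1⟩ hs.1).trans_le hiu
    · exact hmono hs1 hy.le hs.2
  have hC : StrictAntiOn w (Ici y) := by
    refine strictAntiOn_of_deriv_neg (convex_Ici _) hwc.continuousOn fun s hs => ?_
    rw [interior_Ici] at hs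
    rw [(hwd s).deriv, sub_neg, one_lt_div hu]
    exact hmono hy.le (hy.trans hs).le hs
  have hiy : i < y := hi1.trans_lt hy
  have hgap : w i < w y := hB ⟨le_rfl, hiy.le⟩ ⟨hiy.le, le_rfl⟩ hiy
  have hform : ∀ s t, (t - s) - (g t - g s) / h y = w t - w s := fun s t => by
    simp only [hw]; ring
  rw [hform, hform]
  have hup : ∀ t, i ≤ t → t ≠ y → w t < w y := fun t ht hne => by
    rcases hne.lt_or_gt with hlt | hgt
    · exact hB ⟨ht, hlt.le⟩ ⟨hiy.le, le_rfl⟩ hlt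
    · exact hC self_mem_Ici hgt.le hgt
  have hdn : ∀ t, 0 ≤ t → t ≤ y → t ≠ i → w i < w t := fun t h0 ht hne => by
    rcases hne.lt_or_gt with hlt | hgt
    · exact hA ⟨h0, hlt.le⟩ ⟨hi0, le_rfl⟩ hlt
    · exact hB ⟨le_rfl, hiy.le⟩ ⟨hgt.le, ht⟩ hgt
  rcases lt_or_ge y x' with h1 | h1
  · have := hC.antitoneOn h1.le (h1.le.trans hxy) hxy
    constructor
    · linarith
    · intro; linarith
  rcases lt_or_ge y' i with h2 | h2
  · have := hA.antitoneOn ⟨hx', hxy.trans h2.le⟩ ⟨hx'.trans hxy, h2.le⟩ hxy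
    constructor
    · linarith
    · intro; linarith
  by_cases e1 : x' = i <;> by_cases e2 : y' = y
  · subst e1 e2; simp
  · have := hup y' h2 e2
    subst e1
    exact ⟨by linarith, fun _ => by linarith⟩
  · have := hdn x' hx' h1 e1
    subst e2
    exact ⟨by linarith, fun _ => by linarith⟩
  · have := hup y' h2 e2
    have := hdn x' hx' h1 e1
    exact ⟨by linarith, fun _ => by linarith⟩

/-- The maximisers of `(y - x - β) / (g y - g x)` when `g'` is positive, decreasing on `[0, a₁]`,
increasing on `[a₁, ∞)` and unbounded. -/
theorem existsUnique_maximizer_of_deriv {g h : ℝ → ℝ} {a₁ β : ℝ}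
    (hd : ∀ x, HasDerivAt g (h x) x) (hc : Continuous h) (hpos : ∀ x, 0 < h x) (ha₁ : 0 ≤ a₁)
    (hβ : 0 < β) (hanti : StrictAntiOn h (Icc 0 a₁)) (hmono : StrictMonoOn h (Ici a₁))
    (htop : Tendsto h atTop atTop) {ι φ : ℝ → ℝ}
    (hι : ∀ u, ι u = sInf {z : ℝ | z ∈ Icc 0 a₁ ∧ h z ≤ u})
    (hφ : ∀ x, φ x = ∫ s in (ι (h x))..x, (1 - h s / h x)) :
    ∃ z₂ : ℝ, a₁ < z₂ ∧ φ z₂ = β ∧ (∀ w : ℝ, a₁ < w → φ w = β → w = z₂) ∧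
      {p ∈ {p : ℝ × ℝ | 0 ≤ p.1 ∧ 0 ≤ p.2 ∧ p.1 + β ≤ p.2} |
        ∀ p' ∈ {p : ℝ × ℝ | 0 ≤ p.1 ∧ 0 ≤ p.2 ∧ p.1 + β ≤ p.2},
          (p'.2 - p'.1 - β) / (g p'.2 - g p'.1) ≤ (p.2 - p.1 - β) / (g p.2 - g p.1)} =
        {(ι (h z₂), z₂)} := by
  have hgc : Continuous g := continuous_iff_continuousAt.2 fun s => (hd s).continuousAt
  have hgm : StrictMono g := strictMono_of_deriv_pos fun x => by
    rw [(hd x).deriv]; exact hpos x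
  have hint : ∀ x y u : ℝ, ∫ s in x..y, (1 - h s / u) = (y - x) - (g y - g x) / u := by
    intro x y u
    rw [intervalIntegral.integral_eq_sub_of_hasDerivAt (f := fun s => s - g s / u)]
    · ring
    · intro s _
      exact (hasDerivAt_id s).sub ((hd s).div_const _)
    · exact (continuous_const.sub (hc.div_const _)).intervalIntegrable _ _
  have hφ' : ∀ y, φ y = (y - ι (h y)) - (g y - g (ι (h y))) / h y := fun y => by
    rw [hφ, hint]
  have hleast : ∀ y, a₁ < y → IsLeast {z : ℝ | z ∈ Icc 0 a₁ ∧ h z ≤ h y} (ι (h y)) := by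
    intro y hy
    rw [hι]
    exact isLeast_sInf_sublevel hc ha₁ (hmono self_mem_Ici hy.le hy).le
  have hmax : ∀ y, a₁ < y → ∀ x' y', 0 ≤ x' → x' ≤ y' →
      (y' - x') - (g y' - g x') / h y ≤ φ y ∧
      ((y' - x') - (g y' - g x') / h y = φ y → x' = ι (h y) ∧ y' = y) := by
    intro y hy x' y' h0 hxy
    rw [hφ']
    exact increment_le_of_isLeast hd hpos hanti hmono hy (hleast y hy) h0 hxy
  have hφmono : ∀ y y', a₁ < y → y < y' → φ y < φ y' := by
    intro y y' hy hyy
    have hl := hleast y hy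
    have hiy : ι (h y) < y := hl.1.1.2.trans_lt hy
    have h1 := (hmax y' (hy.trans hyy) (ι (h y)) y hl.1.1.1 hiy.le).1
    have h2 : (g y - g (ι (h y))) / h y' < (g y - g (ι (h y))) / h y :=
      div_lt_div_of_pos_left (sub_pos.2 (hgm hiy)) (hpos y)
        (hmono hy.le (hy.trans hyy).le hyy)
    rw [hφ' y]
    linarith
  obtain ⟨z, hz, hzβ⟩ : ∃ z, a₁ < z ∧ φ z = β := by
    let F : ℝ → ℝ → ℝ := fun y x => (y - x) - (g y - g x) / h y
    let G : ℝ → ℝ := fun y => sSup (F y '' Icc 0 a₁)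
    have hG : Continuous G := by
      refine isCompact_Icc.continuous_sSup ?_
      refine (continuous_fst.sub continuous_snd).sub
        (((hgc.comp continuous_fst).sub (hgc.comp continuous_snd)).div
          (hc.comp continuous_fst) fun p => (hpos p.1).ne')
    have hGφ : ∀ y, a₁ < y → G y = φ y := by
      intro y hy
      refine IsGreatest.csSup_eq ⟨⟨ι (h y), (hleast y hy).1.1, (hφ' y).symm⟩, ?_⟩
      rintro _ ⟨x, hx, rfl⟩
      exact (hmax y hy x y hx.1 (hx.2.trans hy.le)).1
    have hGa : G a₁ ≤ 0 := by
      refine csSup_le ⟨_, a₁, ⟨ha₁, le_rfl⟩, rfl⟩ ?_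
      rintro _ ⟨x, hx, rfl⟩
      have : ∫ s in x..a₁, (1 - h s / h a₁) ≤ 0 := by
        have := intervalIntegral.integral_mono_on hx.2
          ((continuous_const.sub (hc.div_const _)).intervalIntegrable _ _)
          (intervalIntegrable_const (c := (0 : ℝ)) (μ := MeasureTheory.volume))
          (f := fun s => 1 - h s / h a₁) (fun s hs => by
            rw [sub_nonpos, one_le_div (hpos _)]
            exact hanti.antitoneOn ⟨hx.1.trans hs.1, hs.2⟩ ⟨ha₁, le_rfl⟩ hs.2)
        simpa using this
      rwa [hint] at this
    obtain ⟨y, hy1, hy2⟩ : ∃ y, a₁ + 2 * β ≤ y ∧ 2 * h (a₁ + 2 * β) ≤ h y :=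
      ((eventually_ge_atTop _).and (htop.eventually_ge_atTop _)).exists
    have hya : a₁ < y := by linarith
    have hGy : β ≤ G y := by
      rw [hGφ y hya]
      refine le_trans ?_ (hmax y hya a₁ (a₁ + 2 * β) ha₁ (by linarith)).1
      rw [← hint]
      have := intervalIntegral.integral_mono_on (a := a₁) (b := a₁ + 2 * β) (by linarith)
          (intervalIntegrable_const (c := (1 / 2 : ℝ)) (μ := MeasureTheory.volume))
          ((continuous_const.sub (hc.div_const _)).intervalIntegrable _ _)
          (g := fun s => 1 - h s / h y) (fun s hs => by
            have h1 : h s ≤ h (a₁ + 2 * β) :=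
              hmono.monotoneOn hs.1 (mem_Ici.2 (by linarith)) hs.2
            have h2 : h s / h y ≤ 1 / 2 := by
              rw [div_le_iff₀ (hpos y)]; linarith
            linarith)
      simp only [intervalIntegral.integral_const, smul_eq_mul] at this
      linarith
    obtain ⟨z, hz, hGz⟩ := intermediate_value_Icc hya.le hG.continuousOn
      (show β ∈ Icc (G a₁) (G y) from ⟨hGa.trans hβ.le, hGy⟩)
    have hza : a₁ < z := by
      rcases hz.1.eq_or_lt with rfl | h1
      · linarith
      · exact h1
    exact ⟨z, hza, by rw [← hGφ z hza, hGz]⟩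
  refine ⟨z, hz, hzβ, fun w hw hwβ => ?_, ?_⟩
  · rcases lt_trichotomy w z with h1 | h1 | h1
    · have := hφmono w z hw h1; linarith
    · exact h1
    · have := hφmono z w hz h1; linarith
  have hl := (hleast z hz).1.1
  have hiz : ι (h z) < z := hl.2.trans_lt hz
  have hgi := sub_pos.2 (hgm hiz)
  have hval : z - ι (h z) - β = (g z - g (ι (h z))) / h z := by
    have := hφ' z
    linarith
  have hzeta : (z - ι (h z) - β) / (g z - g (ι (h z))) = 1 / h z := by
    rw [hval]
    field_simp
  have hmem : (0 : ℝ) ≤ ι (h z) ∧ 0 ≤ z ∧ ι (h z) + β ≤ z :=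
    ⟨hl.1, ha₁.trans hz.le, by have := div_pos hgi (hpos z); linarith⟩
  ext ⟨x, y⟩
  simp only [mem_ofPred_eq, mem_singleton_iff, Prod.mk.injEq]
  constructor
  · rintro ⟨⟨hx, -, hxy⟩, hopt⟩
    have hg := sub_pos.2 (hgm (show x < y by linarith))
    have h1 := hopt (ι (h z), z) hmem
    simp only [hzeta] at h1
    rw [div_le_div_iff₀ (hpos z) hg, one_mul] at h1
    have h2 := hmax z hz x y hx (by linarith)
    have h3 : (g y - g x) / h z ≤ y - x - β := by rwa [div_le_iff₀ (hpos z)]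
    exact h2.2 (le_antisymm h2.1 (by linarith))
  · rintro ⟨rfl, rfl⟩
    refine ⟨hmem, ?_⟩
    rintro ⟨x, y'⟩ ⟨hx, -, hxy⟩
    simp only at hx hxy ⊢
    have hg := sub_pos.2 (hgm (show x < y' by linarith))
    rw [hzeta, div_le_div_iff₀ hg (hpos y), one_mul, ← le_div_iff₀ (hpos y)]
    have h2 := (hmax y hz x y' hx (by linarith)).1
    linarith

theorem sqrt_add_div_pos {μ q σ : ℝ} (hq : 0 < q) (hσ : 0 < σ) :
    0 < (√(μ ^ 2 + 2 * q * σ ^ 2) + μ) / σ ^ 2 := by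
  have h : |μ| < √(μ ^ 2 + 2 * q * σ ^ 2) :=
    Real.lt_sqrt_of_sq_lt (by rw [sq_abs]; have : 0 < 2 * q * σ ^ 2 := by positivity
                              linarith)
  exact div_pos (by linarith [neg_abs_le μ]) (by positivity)

theorem sqrt_sub_div_pos {μ q σ : ℝ} (hq : 0 < q) (hσ : 0 < σ) :
    0 < (√(μ ^ 2 + 2 * q * σ ^ 2) - μ) / σ ^ 2 := by
  have := sqrt_add_div_pos (μ := -μ) hq hσ
  rwa [neg_sq, ← sub_eq_add_neg] at this

theorem hasDerivAt_exp_mul_sub (k a x : ℝ) :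
    HasDerivAt (fun y => exp (k * (y - a))) (k * exp (k * (x - a))) x := by
  have := (((hasDerivAt_id x).sub_const a).const_mul k).exp
  simpa [mul_comm] using this

set_option maxHeartbeats 1000000 in
theorem statement8
    (a q μp μm σp σm : ℝ)
    (ha : 0 < a) (hq : 0 < q) (hσp : 0 < σp) (hσm : 0 < σm)
    (θ1p θ2p θ1m θ2m cm cp : ℝ)
    (hθ1p : θ1p = (Real.sqrt (μp ^ 2 + 2 * q * σp ^ 2) + μp) / σp ^ 2)
    (hθ2p : θ2p = (Real.sqrt (μp ^ 2 + 2 * q * σp ^ 2) - μp) / σp ^ 2)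
    (hθ1m : θ1m = (Real.sqrt (μm ^ 2 + 2 * q * σm ^ 2) + μm) / σm ^ 2)
    (hθ2m : θ2m = (Real.sqrt (μm ^ 2 + 2 * q * σm ^ 2) - μm) / σm ^ 2)
    (hcm : cm = (θ1m - θ1p) / (θ2m + θ1m))
    (hcp : cp = (θ2p - θ2m) / (θ2p + θ1p))
    (gm gp g : ℝ → ℝ)
    (hgm : ∀ x, gm x = if a < x then Real.exp (-θ1p * (x - a))
      else cm * Real.exp (θ2m * (x - a)) + (1 - cm) * Real.exp (-θ1m * (x - a)))
    (hgp : ∀ x, gp x = if a < x then (1 - cp) * Real.exp (θ2p * (x - a)) + cp * Real.exp (-θ1p * (x - a))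
      else Real.exp (θ2m * (x - a)))
    (hg : ∀ x, g x = gp x * gm 0 - gm x * gp 0)
    (β : ℝ) (hβ : 0 < β)
    (Dζ : Set (ℝ × ℝ))
    (hD : Dζ = {p : ℝ × ℝ | 0 ≤ p.1 ∧ 0 ≤ p.2 ∧ p.1 + β ≤ p.2})
    (ζ : ℝ → ℝ → ℝ)
    (hζ : ∀ z₁ z₂, ζ z₁ z₂ = (z₂ - z₁ - β) / (g z₂ - g z₁))
    (Mζ : Set (ℝ × ℝ))
    (hM : Mζ = {p ∈ Dζ | ∀ p' ∈ Dζ, ζ p'.1 p'.2 ≤ ζ p.1 p.2})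
    (ψ : ℝ → ℝ → ℝ)
    (hψ : ∀ x y, ψ x y = ∫ s in x..y, (1 - deriv g s / deriv g y))
    (hμp : 0 < μp) (hμm : 0 < μm)
    (Θ : ℝ)
    (hΘ : Θ = cp * θ1p ^ 2 + (1 - cp) * θ2p ^ 2)
    (a₁ : ℝ)
    (ha₁ : a₁ = 2 * Real.log (θ1m / θ2m) / (θ2m + θ1m))
    (a₂ : ℝ)
    (ha₂ : a₂ = Real.log ((θ2p + θ1m) / (θ2p - θ2m)) / (θ1m + θ2m))
    (a₃ : ℝ)
    (ha₃ : a₃ = Real.log (((1 - cm * cp) * θ1p ^ 2 - (1 - cp) * cm * θ2p ^ 2) / ((1 - cm) * Θ)) / (θ1m + θ2m))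
    (hcase : (0 < cp ∧ max a₁ a₂ ≤ a) ∨
      (0 < cp ∧ max a₁ a₃ ≤ a ∧ a < a₂) ∨
      (cp ≤ 0 ∧ 0 < Θ ∧ max a₁ a₃ ≤ a))
    (ι : ℝ → ℝ)
    (hι : ∀ u, ι u = sInf {z : ℝ | z ∈ Set.Icc 0 a₁ ∧ deriv g z ≤ u})
    (φ : ℝ → ℝ)
    (hφ : ∀ x, φ x = ψ (ι (deriv g x)) x)
    :
    ∃ z₂ : ℝ, a₁ < z₂ ∧ φ z₂ = β ∧ (∀ w : ℝ, a₁ < w → φ w = β → w = z₂) ∧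
      Mζ = {(ι (deriv g z₂), z₂)} := by
  have h1p : 0 < θ1p := hθ1p ▸ sqrt_add_div_pos hq hσp
  have h2p : 0 < θ2p := hθ2p ▸ sqrt_sub_div_pos hq hσp
  have h1m : 0 < θ1m := hθ1m ▸ sqrt_add_div_pos hq hσm
  have h2m : 0 < θ2m := hθ2m ▸ sqrt_sub_div_pos hq hσm
  have h12 : θ2m < θ1m := by
    rw [hθ1m, hθ2m]
    exact div_lt_div_of_pos_right (by linarith) (by positivity)
  have hS : 0 < θ1m + θ2m := by linarith
  have hcm1 : 1 - cm = (θ2m + θ1p) / (θ2m + θ1m) := by rw [hcm]; field_simp; ring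
  have hcp1 : 1 - cp = (θ1p + θ2m) / (θ2p + θ1p) := by rw [hcp]; field_simp; ring
  have hcm0 : 0 < 1 - cm := by rw [hcm1]; positivity
  have hcp0 : 0 < 1 - cp := by rw [hcp1]; positivity
  have hcmS : cm * (θ2m + θ1m) = θ1m - θ1p := by rw [hcm]; field_simp
  have hcpS : cp * (θ2p + θ1p) = θ2p - θ2m := by rw [hcp]; field_simp
  have ha₁0 : 0 ≤ a₁ := by
    rw [ha₁]
    have := Real.log_pos ((one_lt_div h2m).2 h12)
    positivity
  have ha₁a : a₁ ≤ a := by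
    rcases hcase with ⟨_, h⟩ | ⟨_, h, _⟩ | ⟨_, _, h⟩ <;> exact (le_max_left _ _).trans h
  have hea₁ : exp ((θ1m + θ2m) * a₁) = (θ1m / θ2m) ^ 2 := by
    rw [ha₁, ← Real.exp_log (show 0 < (θ1m / θ2m) ^ 2 by positivity), Real.log_pow]
    congr 1
    push_cast
    field_simp
    ring
  obtain ⟨N, hN⟩ : ∃ N, N = exp (-(θ2m * a)) := ⟨_, rfl⟩
  obtain ⟨E, hE⟩ : ∃ E, E = exp (θ1m * a) := ⟨_, rfl⟩
  obtain ⟨P, hP⟩ : ∃ P, P = cm * N + (1 - cm) * E := ⟨_, rfl⟩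
  have hN0 : 0 < N := hN ▸ exp_pos _
  have hE0 : 0 < E := hE ▸ exp_pos _
  have hgp0 : gp 0 = N := by
    rw [hgp, if_neg (not_lt.2 ha.le), hN]; congr 1; ring
  have hgm0 : gm 0 = P := by
    rw [hgm, if_neg (not_lt.2 ha.le), hP, hN, hE]
    congr 3 <;> ring_nf
  have hEN : E = exp ((θ1m + θ2m) * a) * N := by
    rw [hE, hN, ← exp_add]; congr 1; ring
  have hP0 : 0 < P := by
    have : N < E := by
      rw [hE, hN, exp_lt_exp]; linarith [mul_pos h1m ha, mul_pos h2m ha]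
    have : 0 < (1 - cm) * (E - N) := mul_pos hcm0 (by linarith)
    rw [hP]; linarith
  -- the two branches of `g` and their derivatives
  let f₁ : ℝ → ℝ := fun x => (1 - cm) * (E * exp (θ2m * (x - a)) - N * exp (-θ1m * (x - a)))
  let f₁' : ℝ → ℝ := fun x =>
    (1 - cm) * (E * (θ2m * exp (θ2m * (x - a))) - N * (-θ1m * exp (-θ1m * (x - a))))
  let f₂ : ℝ → ℝ := fun x =>
    (1 - cp) * P * exp (θ2p * (x - a)) + (cp * P - N) * exp (-θ1p * (x - a))
  let f₂' : ℝ → ℝ := fun x =>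
    (1 - cp) * P * (θ2p * exp (θ2p * (x - a))) + (cp * P - N) * (-θ1p * exp (-θ1p * (x - a)))
  have hgf : g = fun x => if a < x then f₂ x else f₁ x := by
    funext x
    rw [hg, hgp0, hgm0, hgp, hgm]
    split_ifs
    · simp only [f₂]; ring
    · simp only [f₁, hP]; ring
  have hd₁ : ∀ x, HasDerivAt f₁ (f₁' x) x := fun x =>
    (((hasDerivAt_exp_mul_sub _ _ x).const_mul _).sub
      ((hasDerivAt_exp_mul_sub _ _ x).const_mul _)).const_mul _
  have hd₂ : ∀ x, HasDerivAt f₂ (f₂' x) x := fun x =>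
    ((hasDerivAt_exp_mul_sub _ _ x).const_mul _).add
      ((hasDerivAt_exp_mul_sub _ _ x).const_mul _)
  have hd₁' : ∀ x, HasDerivAt f₁' ((1 - cm) * (E * (θ2m * (θ2m * exp (θ2m * (x - a))))
      - N * (-θ1m * (-θ1m * exp (-θ1m * (x - a)))))) x := fun x =>
    ((((hasDerivAt_exp_mul_sub _ _ x).const_mul _).const_mul _).sub
      (((hasDerivAt_exp_mul_sub _ _ x).const_mul _).const_mul _)).const_mul _
  have hd₂' : ∀ x, HasDerivAt f₂' ((1 - cp) * P * (θ2p * (θ2p * exp (θ2p * (x - a))))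
      + (cp * P - N) * (-θ1p * (-θ1p * exp (-θ1p * (x - a))))) x := fun x =>
    (((hasDerivAt_exp_mul_sub _ _ x).const_mul _).const_mul _).add
      (((hasDerivAt_exp_mul_sub _ _ x).const_mul _).const_mul _)
  have hc₁ : Continuous f₁' := continuous_iff_continuousAt.2 fun s => (hd₁' s).continuousAt
  have hc₂ : Continuous f₂' := continuous_iff_continuousAt.2 fun s => (hd₂' s).continuousAt
  have hfa : f₁ a = f₂ a := by
    simp only [f₁, f₂, sub_self, mul_zero, exp_zero, hP]; ring
  have hfa' : f₁' a = f₂' a := by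
    simp only [f₁', f₂', sub_self, mul_zero, exp_zero]
    linear_combination P * hcpS - N * hcmS - θ2m * hP
  let h : ℝ → ℝ := fun x => if a < x then f₂' x else f₁' x
  have hd : ∀ x, HasDerivAt g (h x) x := by
    rw [hgf]; exact hasDerivAt_ite_lt hd₁ hd₂ hfa hfa'
  have hh₁ : ∀ x, x ≤ a → h x = f₁' x := fun x hx => if_neg (not_lt.2 hx)
  have hh₂ : ∀ x, a ≤ x → h x = f₂' x := fun x hx => by
    rcases hx.eq_or_lt with rfl | hx
    · rw [hh₁ _ le_rfl, hfa']
    · exact if_pos hx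
  have hc : Continuous h := by
    have : h = fun x => if x ≤ a then f₁' x else f₂' x := by
      funext x
      split_ifs with hx
      · exact hh₁ x hx
      · exact hh₂ x (not_le.1 hx).le
    rw [this]
    exact Continuous.if_le hc₁ hc₂ continuous_id continuous_const fun x hx => by
      rw [show x = a from hx, hfa']
  have hexp : ∀ x, E * exp (θ2m * (x - a)) =
      exp ((θ1m + θ2m) * x) * (N * exp (-θ1m * (x - a))) := fun x => by
    rw [hE, hN, ← exp_add, ← exp_add, ← exp_add]; congr 1; ring
  have hfact : ∀ x, (1 - cm) * (E * (θ2m * (θ2m * exp (θ2m * (x - a))))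
      - N * (-θ1m * (-θ1m * exp (-θ1m * (x - a))))) =
      (1 - cm) * (N * exp (-θ1m * (x - a))) * θ2m ^ 2 *
        (exp ((θ1m + θ2m) * x) - exp ((θ1m + θ2m) * a₁)) := fun x => by
    have : θ2m ^ 2 * exp ((θ1m + θ2m) * a₁) = θ1m ^ 2 := by rw [hea₁]; field_simp
    linear_combination (1 - cm) * θ2m ^ 2 * hexp x
      + (1 - cm) * (N * exp (-θ1m * (x - a))) * this
  have hcoef : ∀ x, 0 < (1 - cm) * (N * exp (-θ1m * (x - a))) * θ2m ^ 2 := fun x => by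
    positivity
  have hanti : StrictAntiOn h (Icc 0 a₁) := by
    have : StrictAntiOn f₁' (Icc 0 a₁) := by
      refine strictAntiOn_of_deriv_neg (convex_Icc _ _) hc₁.continuousOn fun s hs => ?_
      rw [interior_Icc] at hs
      rw [(hd₁' s).deriv, hfact]
      refine mul_neg_of_pos_of_neg (hcoef s) (sub_neg.2 (exp_lt_exp.2 ?_))
      exact mul_lt_mul_of_pos_left hs.2 hS
    exact this.congr fun x hx => (hh₁ x (hx.2.trans ha₁a)).symm
  have hmono₁ : StrictMonoOn h (Icc a₁ a) := by
    have : StrictMonoOn f₁' (Icc a₁ a) := by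
      refine strictMonoOn_of_deriv_pos (convex_Icc _ _) hc₁.continuousOn fun s hs => ?_
      rw [interior_Icc] at hs
      rw [(hd₁' s).deriv, hfact]
      refine mul_pos (hcoef s) (sub_pos.2 (exp_lt_exp.2 ?_))
      exact mul_lt_mul_of_pos_left hs.1 hS
    exact this.congr fun x hx => (hh₁ x hx.2).symm
  -- a logarithmic lower bound for `a` as a bound for `exp ((θ1m + θ2m) * a)`
  have hlog : ∀ r, Real.log r / (θ1m + θ2m) ≤ a → r ≤ exp ((θ1m + θ2m) * a) := fun r hr => by
    rcases le_or_gt r 0 with h0 | h0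
    · exact h0.trans (exp_pos _).le
    · rw [← Real.log_le_iff_le_exp h0]
      rwa [div_le_iff₀ hS, mul_comm] at hr
  have hcurv₃ : 0 < Θ → a₃ ≤ a → 0 ≤ (1 - cp) * P * θ2p ^ 2 + (cp * P - N) * θ1p ^ 2 := by
    intro hΘ0 h3
    rw [ha₃] at h3
    have h4 := hlog _ h3
    rw [div_le_iff₀ (by positivity)] at h4
    have h5 := mul_le_mul_of_nonneg_right h4 hN0.le
    have : (1 - cp) * P * θ2p ^ 2 + (cp * P - N) * θ1p ^ 2
        = exp ((θ1m + θ2m) * a) * ((1 - cm) * Θ) * N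
          - ((1 - cm * cp) * θ1p ^ 2 - (1 - cp) * cm * θ2p ^ 2) * N := by
      rw [hP, hEN, hΘ]; ring
    linarith
  have hcurv : 0 ≤ (1 - cp) * P * θ2p ^ 2 + (cp * P - N) * θ1p ^ 2 := by
    rcases hcase with ⟨hcp', hm⟩ | ⟨hcp', hm, _⟩ | ⟨_, hΘ0, hm⟩
    · have h2 : a₂ ≤ a := (le_max_right _ _).trans hm
      have hpm : 0 < θ2p - θ2m := by rw [← hcpS]; positivity
      rw [ha₂] at h2
      have h4 := hlog _ h2
      rw [div_le_iff₀ hpm] at h4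
      have hB : 0 ≤ cp * P - N := by
        have : cp * P - N = (θ2m + θ1p) / ((θ2p + θ1p) * (θ2m + θ1m)) * N *
            (exp ((θ1m + θ2m) * a) * (θ2p - θ2m) - (θ2p + θ1m)) := by
          rw [hP, hEN, hcm1, hcm, hcp]
          field_simp
          ring
        rw [this]
        exact mul_nonneg (by positivity) (by linarith)
      positivity
    · exact hcurv₃ (by rw [hΘ]; positivity) ((le_max_right _ _).trans hm)
    · exact hcurv₃ hΘ0 ((le_max_right _ _).trans hm)
  have hmono₂ : StrictMonoOn h (Ici a) := by
    have : StrictMonoOn f₂' (Ici a) := by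
      refine strictMonoOn_of_deriv_pos (convex_Ici _) hc₂.continuousOn fun s hs => ?_
      rw [interior_Ici] at hs
      rw [(hd₂' s).deriv]
      have hlt : exp (-θ1p * (s - a)) < exp (θ2p * (s - a)) :=
        exp_lt_exp.2 (mul_lt_mul_of_pos_right (by linarith) (sub_pos.2 hs))
      have h1 : 0 < (1 - cp) * P * θ2p ^ 2 * (exp (θ2p * (s - a)) - exp (-θ1p * (s - a))) :=
        mul_pos (by positivity) (by linarith)
      have h2 := mul_nonneg hcurv (exp_pos (-θ1p * (s - a))).le
      linarith
    exact this.congr fun x hx => (hh₂ x hx).symm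
  have hmono : StrictMonoOn h (Ici a₁) := by
    rw [← Icc_union_Ici_eq_Ici ha₁a]
    exact hmono₁.union hmono₂ (isGreatest_Icc ha₁a) isLeast_Ici
  have hpos₁ : ∀ x, x ≤ a → 0 < h x := fun x hx => by
    rw [hh₁ x hx]
    have : 0 < (1 - cm) * (E * (θ2m * exp (θ2m * (x - a)))
        + N * (θ1m * exp (-θ1m * (x - a)))) := by positivity
    simp only [f₁']
    linarith
  have hpos : ∀ x, 0 < h x := fun x => by
    rcases le_total x a with hx | hx
    · exact hpos₁ x hx
    · exact (hpos₁ a le_rfl).trans_le (hmono₂.monotoneOn self_mem_Ici hx hx)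
  have htop : Tendsto h atTop atTop := by
    have hA : Tendsto (fun x => x - a) atTop atTop := tendsto_atTop_add_const_right _ _ tendsto_id
    have h1 : Tendsto (fun x => (1 - cp) * P * (θ2p * exp (θ2p * (x - a)))) atTop atTop :=
      ((tendsto_exp_atTop.comp (hA.const_mul_atTop h2p)).const_mul_atTop h2p).const_mul_atTop
        (mul_pos hcp0 hP0)
    have h2 : Tendsto (fun x => (cp * P - N) * (-θ1p * exp (-θ1p * (x - a)))) atTop
        (nhds ((cp * P - N) * (-θ1p * 0))) :=
      ((tendsto_exp_atBot.comp (hA.const_mul_atTop_of_neg (neg_lt_zero.2 h1p))).const_mul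
        _).const_mul _
    refine (h1.atTop_add h2).congr' ?_
    filter_upwards [eventually_ge_atTop a] with x hx
    exact (hh₂ x hx).symm
  have hderiv : deriv g = h := funext fun x => (hd x).deriv
  simp only [hderiv, hψ, hM, hD, hζ] at hι hφ ⊢
  exact existsUnique_maximizer_of_deriv hd hc hpos ha₁0 hβ hanti hmono htop hι hφ
end

section
/- Assume μ₊ ≤ 0 and μ₋ ≤ 0. Then there exists a unique z₂ ∈ (0,∞) with ψ(0,z₂) = β, and M_ζ = {(0, z₂)}. -/
open Real Set Filter

/-- Two functions that agree to first order at `a` glue to a differentiable function. -/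
theorem hasDerivAt_ite_lt_s10 {a : ℝ} {u v u' v' : ℝ → ℝ}
    (hu : ∀ x, HasDerivAt u (u' x) x) (hv : ∀ x, HasDerivAt v (v' x) x)
    (h : u a = v a) (h' : u' a = v' a) (x : ℝ) :
    HasDerivAt (fun x => if a < x then v x else u x) (if a < x then v' x else u' x) x := by
  rcases lt_trichotomy x a with hx | rfl | hx
  · rw [if_neg hx.le.not_gt]
    refine (hu x).congr_of_eventuallyEq ?_
    filter_upwards [Iio_mem_nhds hx] with y hy
    exact if_neg (not_lt.2 (le_of_lt hy))
  · rw [if_neg (lt_irrefl x), ← hasDerivWithinAt_univ, ← Iic_union_Ici (a := x)]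
    refine HasDerivWithinAt.union ?_ ?_
    · exact (hu x).hasDerivWithinAt.congr (fun y hy => if_neg (not_lt.2 hy))
        (if_neg (lt_irrefl x))
    · rw [h']
      refine (hv x).hasDerivWithinAt.congr (fun y hy => ?_) ?_
      · rcases (show x ≤ y from hy).eq_or_lt with rfl | hy
        · simp [h]
        · exact if_pos hy
      · simp [h]
  · rw [if_pos hx]
    refine (hv x).congr_of_eventuallyEq ?_
    filter_upwards [Ioi_mem_nhds hx] with y hy
    exact if_pos hy

/-- Strictly increasing pieces on `[b, a]` and `[a, ∞)` glue to a strictly increasing function. -/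
theorem strictMonoOn_ite_lt {a b : ℝ} {u v : ℝ → ℝ} (hb : b ≤ a)
    (hu : StrictMonoOn u (Icc b a)) (hv : StrictMonoOn v (Ici a)) (h : u a = v a) :
    StrictMonoOn (fun x => if a < x then v x else u x) (Ici b) := by
  rw [← Icc_union_Ici_eq_Ici hb]
  refine StrictMonoOn.union (c := a) (hu.congr fun x hx => ?_) (hv.congr fun x hx => ?_)
    (isGreatest_Icc hb) isLeast_Ici
  · exact (if_neg (not_lt.2 hx.2)).symm
  · rcases (show a ≤ x from hx).eq_or_lt with rfl | hx
    · simp [h]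
    · exact (if_pos hx).symm

section StrictlyIncreasingDerivative

variable {g G : ℝ → ℝ}

theorem tangent_lt_of_strictMonoOn (hd : ∀ x, HasDerivAt g (G x) x)
    (hG : StrictMonoOn G (Ici 0)) {x y : ℝ} (hx : 0 ≤ x) (hy : 0 ≤ y) (hxy : y ≠ x) :
    g x + G x * (y - x) < g y := by
  have hc : Continuous g := continuous_iff_continuousAt.2 fun x => (hd x).continuousAt
  rcases lt_or_gt_of_ne hxy with h | h
  · obtain ⟨c, ⟨h1, h2⟩, hc⟩ := exists_hasDerivAt_eq_slope g G h hc.continuousOn fun z _ => hd z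
    have := hG (mem_Ici.2 (hy.trans h1.le)) (mem_Ici.2 hx) h2
    rw [eq_div_iff (by linarith)] at hc
    nlinarith
  · obtain ⟨c, ⟨h1, h2⟩, hc⟩ := exists_hasDerivAt_eq_slope g G h hc.continuousOn fun z _ => hd z
    have := hG (mem_Ici.2 hx) (mem_Ici.2 (hx.trans h1.le)) h1
    rw [eq_div_iff (by linarith)] at hc
    nlinarith

theorem increment_lt_of_strictMonoOn (hd : ∀ x, HasDerivAt g (G x) x)
    (hG : StrictMonoOn G (Ici 0)) {x d : ℝ} (hx : 0 < x) (hd0 : 0 < d) :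
    g d - g 0 < g (x + d) - g x := by
  have hD : ∀ y, HasDerivAt (fun y => g (x + y) - g y) (G (x + y) - G y) y := fun y =>
    ((hd (x + y)).comp_const_add x y).sub (hd y)
  obtain ⟨c, ⟨h1, h2⟩, hc⟩ := exists_hasDerivAt_eq_slope _ _ hd0
    (fun y _ => (hD y).continuousAt.continuousWithinAt) fun y _ => hD y
  have := hG (mem_Ici.2 h1.le) (mem_Ici.2 (by linarith : 0 ≤ x + c)) (by linarith)
  rw [eq_div_iff (by linarith)] at hc
  simp only [add_zero] at hc
  nlinarith

theorem lt_of_hasDerivAt_pos (hd : ∀ x, HasDerivAt g (G x) x) (hG : ∀ x, 0 ≤ x → 0 < G x)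
    {x y : ℝ} (hx : 0 ≤ x) (hxy : x < y) : g x < g y := by
  obtain ⟨c, ⟨h1, h2⟩, hc⟩ := exists_hasDerivAt_eq_slope g G hxy
    (fun y _ => (hd y).continuousAt.continuousWithinAt) fun y _ => hd y
  have := hG c (hx.trans h1.le)
  rw [eq_div_iff (by linarith)] at hc
  nlinarith

/-- For `g` with positive, strictly increasing derivative `G` and `g ≤ K G` near infinity, the
quotient `(y - x - β) / (g y - g x)` has a unique maximizer over `0 ≤ x`, `x + β ≤ y`; it is
`(0, z)`, where `z` is the unique solution of `G z * (z - β) = g z`. -/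
theorem exists_unique_maximizer {β K b : ℝ} (hβ : 0 < β)
    (hd : ∀ x, HasDerivAt g (G x) x) (hcG : Continuous G) (hG : StrictMonoOn G (Ici 0))
    (hG0 : 0 < G 0) (hg0 : g 0 = 0) (hK : ∀ y, b < y → g y ≤ K * G y) :
    ∃ z, β < z ∧ G z * (z - β) = g z ∧ (∀ w, 0 < w → G w * (w - β) = g w → w = z) ∧
      (∀ x y, 0 ≤ x → x + β ≤ y → (x, y) ≠ (0, z) →
        (y - x - β) / (g y - g x) < (z - 0 - β) / (g z - g 0)) := by
  have hpos : ∀ x, 0 ≤ x → 0 < G x := fun x hx =>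
    hG0.trans_le (hG.monotoneOn self_mem_Ici (mem_Ici.2 hx) hx)
  have hgpos : ∀ x, 0 < x → 0 < g x := fun x hx => by
    simpa [hg0] using lt_of_hasDerivAt_pos hd hpos le_rfl hx
  have hcg : Continuous g := continuous_iff_continuousAt.2 fun x => (hd x).continuousAt
  have hz : ∃ z, β < z ∧ G z * (z - β) = g z := by
    set Y := max (β + K + 1) (max (β + 1) (b + 1)) with hY
    have h1 : β + K + 1 ≤ Y := le_max_left _ _
    have h2 : β + 1 ≤ Y := (le_max_left _ _).trans (le_max_right _ _)
    have h3 : b + 1 ≤ Y := (le_max_right _ _).trans (le_max_right _ _)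
    have hYpos := hpos Y (by linarith)
    have hYK := hK Y (by linarith)
    have hc : ContinuousOn (fun y => G y * (y - β) - g y) (Icc β Y) := by fun_prop
    obtain ⟨z, hz, hz0⟩ := intermediate_value_Ioo (by linarith : β ≤ Y) hc
      (show (0 : ℝ) ∈ _ from ⟨by simpa using hgpos β hβ, by nlinarith⟩)
    exact ⟨z, hz.1, sub_eq_zero.1 hz0⟩
  obtain ⟨z, hβz, hz⟩ := hz
  have hz0 : 0 < z := hβ.trans hβz
  have key : ∀ y, 0 ≤ y → y ≠ z → G z * (y - β) < g y := fun y hy hne => by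
    have := tangent_lt_of_strictMonoOn hd hG hz0.le hy hne
    linarith
  have hval : (z - 0 - β) / (g z - g 0) = 1 / G z := by
    rw [hg0, ← hz, sub_zero, sub_zero, div_eq_div_iff]
    · ring
    · exact (mul_pos (hpos z hz0.le) (sub_pos.2 hβz)).ne'
    · exact (hpos z hz0.le).ne'
  refine ⟨z, hβz, hz, fun w hw hwz => ?_, fun x y hx hxy hne => ?_⟩
  · by_contra hne
    have h1 := key w hw.le hne
    have h2 := tangent_lt_of_strictMonoOn hd hG hw.le hz0.le (Ne.symm hne)
    have h3 : 0 < w - β := by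
      have := hgpos w hw
      rw [← hwz] at this
      exact pos_of_mul_pos_right this (hpos w hw.le).le
    have h4 : G z < G w := lt_of_mul_lt_mul_right (hwz ▸ h1) h3.le
    have h5 : G w * (z - β) < G z * (z - β) := by linarith
    exact lt_asymm h4 (lt_of_mul_lt_mul_right h5 (by linarith))
  · have hGz := hpos z hz0.le
    have hgxy := lt_of_hasDerivAt_pos hd hpos hx (by linarith : x < y)
    rw [hval, div_lt_div_iff₀ (by linarith) hGz, one_mul]
    rcases hx.eq_or_lt with rfl | hx
    · have := key y (by linarith) fun h => hne (by rw [h])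
      linarith
    · have h1 := increment_lt_of_strictMonoOn hd hG hx (by linarith : 0 < y - x)
      rw [add_sub_cancel, hg0] at h1
      have h2 : G z * (y - x - β) ≤ g (y - x) := by
        by_cases h : y - x = z
        · rw [h, hz]
        · exact (key _ (by linarith) h).le
      linarith

end StrictlyIncreasingDerivative

/-- The two roots `(√(μ² + 2qσ²) ± μ) / σ²` are positive, and ordered when `μ ≤ 0`. -/
theorem characteristic_roots {μ q σ t₁ t₂ : ℝ} (hq : 0 < q) (hσ : 0 < σ) (hμ : μ ≤ 0)
    (h₁ : t₁ = (√(μ ^ 2 + 2 * q * σ ^ 2) + μ) / σ ^ 2)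
    (h₂ : t₂ = (√(μ ^ 2 + 2 * q * σ ^ 2) - μ) / σ ^ 2) : 0 < t₁ ∧ t₁ ≤ t₂ := by
  have h : -μ < √(μ ^ 2 + 2 * q * σ ^ 2) := by
    apply Real.lt_sqrt_of_sq_lt
    have : 0 < 2 * q * σ ^ 2 := by positivity
    linarith [neg_sq μ]
  refine ⟨h₁ ▸ div_pos (by linarith) (by positivity), ?_⟩
  rw [h₁, h₂]
  gcongr
  linarith

theorem hasDerivAt_const_mul_exp (A t a x : ℝ) :
    HasDerivAt (fun x => A * exp (t * (x - a))) (A * t * exp (t * (x - a))) x := by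
  have h := ((((hasDerivAt_id x).sub_const a).const_mul t).exp).const_mul A
  refine h.congr_deriv ?_
  simp only [id]
  ring

/-- If `A exp (t₂ s) + B exp (-t₁ s)` has positive value and slope at `s = 0` and `t₁ ≤ t₂`,
then its derivative is strictly increasing on `s ≥ 0`. -/
theorem strictMonoOn_deriv_exp_add_exp {A B t₁ t₂ a : ℝ} (ht₁ : 0 < t₁) (ht : t₁ ≤ t₂)
    (hv : 0 ≤ A + B) (hs : 0 < A * t₂ + B * -t₁) :
    StrictMonoOn (fun x => A * t₂ * exp (t₂ * (x - a)) + B * -t₁ * exp (-t₁ * (x - a)))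
      (Ici a) := by
  have hD : ∀ x, HasDerivAt
      (fun x => A * t₂ * exp (t₂ * (x - a)) + B * -t₁ * exp (-t₁ * (x - a)))
      (A * t₂ * t₂ * exp (t₂ * (x - a)) + B * -t₁ * -t₁ * exp (-t₁ * (x - a))) x := fun x =>
    (hasDerivAt_const_mul_exp _ _ _ _).add (hasDerivAt_const_mul_exp _ _ _ _)
  refine strictMonoOn_of_deriv_pos (convex_Ici a)
    (fun x _ => (hD x).continuousAt.continuousWithinAt) fun x hx => ?_
  rw [interior_Ici] at hx
  have hx : 0 < x - a := sub_pos.2 hx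
  rw [(hD x).deriv]
  have ht₂ : 0 < t₂ := ht₁.trans_le ht
  have hA : 0 < A := by
    have : 0 < A * (t₁ + t₂) := by nlinarith
    exact pos_of_mul_pos_left this (by linarith)
  have h1 : exp (-t₁ * (x - a)) < exp (t₂ * (x - a)) := exp_lt_exp.2 (by nlinarith)
  have h0 := exp_pos (-t₁ * (x - a))
  have h2 : 0 < A * t₂ * t₂ := by positivity
  have h3 : 0 ≤ A * t₂ * t₂ + B * -t₁ * -t₁ := by
    have : 0 ≤ A * (t₂ * t₂ - t₁ * t₁) := mul_nonneg hA.le (by nlinarith)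
    have : 0 ≤ (A + B) * (t₁ * t₁) := by positivity
    linarith
  nlinarith

/-- Glue `k (exp (t₂ x) - exp (-t₁ x))` on `x ≤ a` with a combination of `exp (s₂ (x - a))` and
`exp (-s₁ (x - a))` on `x > a`. If the pieces agree to first order at `a` and `t₁ ≤ t₂`, `s₁ ≤ s₂`,
the derivative is positive and strictly increasing on `[0, ∞)` and eventually dominates the
function. -/
theorem exists_deriv_of_glued_exp {a k A B t₁ t₂ s₁ s₂ : ℝ} {g u u' v v' : ℝ → ℝ}
    (ha : 0 < a) (hk0 : 0 < k) (ht₁ : 0 < t₁) (ht : t₁ ≤ t₂) (hs₁ : 0 < s₁) (hs : s₁ ≤ s₂)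
    (hu : u = fun x => k * exp (t₂ * (x - 0)) + -k * exp (-t₁ * (x - 0)))
    (hu' : u' = fun x => k * t₂ * exp (t₂ * (x - 0)) + -k * -t₁ * exp (-t₁ * (x - 0)))
    (hv : v = fun x => A * exp (s₂ * (x - a)) + B * exp (-s₁ * (x - a)))
    (hv' : v' = fun x => A * s₂ * exp (s₂ * (x - a)) + B * -s₁ * exp (-s₁ * (x - a)))
    (hglue : u a = v a) (hglue' : u' a = v' a)
    (hgu : g = fun x => if a < x then v x else u x) :
    ∃ G : ℝ → ℝ, (∀ x, HasDerivAt g (G x) x) ∧ Continuous G ∧ StrictMonoOn G (Ici 0) ∧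
      0 < G 0 ∧ ∃ K, ∀ y, a < y → g y ≤ K * G y := by
  have hs₂ := hs₁.trans_le hs
  have ht₂ := ht₁.trans_le ht
  have hva : v a = A + B := by simp [hv]
  have hv'a : v' a = A * s₂ + B * -s₁ := by simp [hv']
  have hdu : ∀ x, HasDerivAt u (u' x) x := fun x => by
    rw [hu, hu']
    exact (hasDerivAt_const_mul_exp _ _ _ _).add (hasDerivAt_const_mul_exp _ _ _ _)
  have hdv : ∀ x, HasDerivAt v (v' x) x := fun x => by
    rw [hv, hv']
    exact (hasDerivAt_const_mul_exp _ _ _ _).add (hasDerivAt_const_mul_exp _ _ _ _)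
  have hmu : StrictMonoOn u' (Ici 0) := hu' ▸
    strictMonoOn_deriv_exp_add_exp ht₁ ht (by linarith) (by nlinarith)
  have hu'0 : 0 < u' 0 := by
    simp only [hu', sub_zero, mul_zero, exp_zero]; nlinarith
  have hu'pos : ∀ x, 0 ≤ x → 0 < u' x := fun x hx =>
    hu'0.trans_le (hmu.monotoneOn self_mem_Ici (mem_Ici.2 hx) hx)
  have hua0 : 0 < u a := by
    have := lt_of_hasDerivAt_pos hdu hu'pos le_rfl ha
    simpa [hu] using this
  have hmv : StrictMonoOn v' (Ici a) := by
    rw [hv']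
    refine strictMonoOn_deriv_exp_add_exp hs₁ hs ?_ ?_
    · rw [← hva, ← hglue]; exact hua0.le
    · rw [← hv'a, ← hglue']; exact hu'pos a ha.le
  set G : ℝ → ℝ := fun x => if a < x then v' x else u' x with hGdef
  have hd : ∀ x, HasDerivAt g (G x) x := fun x => by
    rw [hgu]; exact hasDerivAt_ite_lt_s10 hdu hdv hglue hglue' x
  have hG : StrictMonoOn G (Ici 0) :=
    strictMonoOn_ite_lt ha.le (hmu.mono Icc_subset_Ici_self) hmv hglue'
  have hcu : Continuous u' := by rw [hu']; fun_prop
  have hcv : Continuous v' := by rw [hv']; fun_prop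
  have hcG : Continuous G := by
    have h : G = fun x => if x ≤ a then u' x else v' x := by
      funext x
      by_cases hx : a < x
      · simp [hGdef, hx, hx.not_ge]
      · simp [hGdef, hx, not_lt.1 hx]
    rw [h]
    exact Continuous.if_le hcu hcv continuous_id continuous_const
      (by rintro x rfl; exact hglue')
  have hG0 : G 0 = u' 0 := if_neg ha.le.not_gt
  refine ⟨G, hd, hcG, hG, hG0 ▸ hu'0, (1 + |B| * (s₂ + s₁) / u' 0) / s₂, fun y hy => ?_⟩
  have h1 : g y = v y := by rw [hgu]; exact if_pos hy
  have h2 : G y = v' y := if_pos hy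
  have h3 : u' 0 ≤ G y := hG0 ▸ hG.monotoneOn self_mem_Ici (mem_Ici.2 (ha.trans hy).le)
    (ha.trans hy).le
  have h4 : |B| * (s₂ + s₁) ≤ |B| * (s₂ + s₁) / u' 0 * G y := by
    rw [div_mul_eq_mul_div, le_div_iff₀ hu'0]; gcongr
  have h5 : exp (-s₁ * (y - a)) ≤ 1 := exp_le_one_iff.2 (by nlinarith)
  have h6 : B * exp (-s₁ * (y - a)) ≤ |B| :=
    (mul_le_mul_of_nonneg_right (le_abs_self B) (exp_pos _).le).trans
      (mul_le_of_le_one_right (abs_nonneg B) h5)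
  have h7 : g y * s₂ = G y + B * exp (-s₁ * (y - a)) * (s₂ + s₁) := by
    rw [h1, h2]; simp only [hv, hv']; ring
  rw [div_mul_eq_mul_div, le_div_iff₀ hs₂, h7]
  nlinarith

theorem statement10
    (a q μp μm σp σm : ℝ)
    (ha : 0 < a) (hq : 0 < q) (hσp : 0 < σp) (hσm : 0 < σm)
    (θ1p θ2p θ1m θ2m cm cp : ℝ)
    (hθ1p : θ1p = (Real.sqrt (μp ^ 2 + 2 * q * σp ^ 2) + μp) / σp ^ 2)
    (hθ2p : θ2p = (Real.sqrt (μp ^ 2 + 2 * q * σp ^ 2) - μp) / σp ^ 2)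
    (hθ1m : θ1m = (Real.sqrt (μm ^ 2 + 2 * q * σm ^ 2) + μm) / σm ^ 2)
    (hθ2m : θ2m = (Real.sqrt (μm ^ 2 + 2 * q * σm ^ 2) - μm) / σm ^ 2)
    (hcm : cm = (θ1m - θ1p) / (θ2m + θ1m))
    (hcp : cp = (θ2p - θ2m) / (θ2p + θ1p))
    (gm gp g : ℝ → ℝ)
    (hgm : ∀ x, gm x = if a < x then Real.exp (-θ1p * (x - a))
      else cm * Real.exp (θ2m * (x - a)) + (1 - cm) * Real.exp (-θ1m * (x - a)))
    (hgp : ∀ x, gp x = if a < x then (1 - cp) * Real.exp (θ2p * (x - a)) + cp * Real.exp (-θ1p * (x - a))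
      else Real.exp (θ2m * (x - a)))
    (hg : ∀ x, g x = gp x * gm 0 - gm x * gp 0)
    (β : ℝ) (hβ : 0 < β)
    (Dζ : Set (ℝ × ℝ))
    (hD : Dζ = {p : ℝ × ℝ | 0 ≤ p.1 ∧ 0 ≤ p.2 ∧ p.1 + β ≤ p.2})
    (ζ : ℝ → ℝ → ℝ)
    (hζ : ∀ z₁ z₂, ζ z₁ z₂ = (z₂ - z₁ - β) / (g z₂ - g z₁))
    (Mζ : Set (ℝ × ℝ))
    (hM : Mζ = {p ∈ Dζ | ∀ p' ∈ Dζ, ζ p'.1 p'.2 ≤ ζ p.1 p.2})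
    (ψ : ℝ → ℝ → ℝ)
    (hψ : ∀ x y, ψ x y = ∫ s in x..y, (1 - deriv g s / deriv g y))
    (hμp : μp ≤ 0) (hμm : μm ≤ 0)
    :
    ∃ z₂ : ℝ, 0 < z₂ ∧ ψ 0 z₂ = β ∧ (∀ w : ℝ, 0 < w → ψ 0 w = β → w = z₂) ∧
      Mζ = {((0 : ℝ), z₂)} := by
  obtain ⟨hs₁, hs⟩ := characteristic_roots hq hσp hμp hθ1p hθ2p
  obtain ⟨ht₁, ht⟩ := characteristic_roots hq hσm hμm hθ1m hθ2m
  clear hθ1p hθ2p hθ1m hθ2m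
  have hs₂ := hs₁.trans_le hs
  have ht₂ := ht₁.trans_le ht
  have hcm1 : cm * (θ2m + θ1m) = θ1m - θ1p := by rw [hcm]; field_simp
  have hcp1 : cp * (θ2p + θ1p) = θ2p - θ2m := by rw [hcp]; field_simp
  have hcm_lt : 0 < 1 - cm := by
    have : 0 < (1 - cm) * (θ2m + θ1m) := by linarith
    exact pos_of_mul_pos_left this (by linarith)
  have hgp0 : gp 0 = exp (θ2m * (0 - a)) := by rw [hgp, if_neg ha.le.not_gt]
  have hgm0 : gm 0 = cm * exp (θ2m * (0 - a)) + (1 - cm) * exp (-θ1m * (0 - a)) := by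
    rw [hgm, if_neg ha.le.not_gt]
  obtain ⟨k, hk⟩ : ∃ k, k = (1 - cm) * exp (-θ1m * (0 - a)) * exp (θ2m * (0 - a)) := ⟨_, rfl⟩
  have hk0 : 0 < k := by rw [hk]; positivity
  obtain ⟨A, hA⟩ : ∃ r, r = (1 - cp) * gm 0 := ⟨_, rfl⟩
  obtain ⟨B, hB⟩ : ∃ r, r = cp * gm 0 - gp 0 := ⟨_, rfl⟩
  obtain ⟨u, hu⟩ : ∃ f : ℝ → ℝ, f = fun x =>
    k * exp (θ2m * (x - 0)) + -k * exp (-θ1m * (x - 0)) := ⟨_, rfl⟩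
  obtain ⟨v, hv⟩ : ∃ f : ℝ → ℝ, f = fun x =>
    A * exp (θ2p * (x - a)) + B * exp (-θ1p * (x - a)) := ⟨_, rfl⟩
  obtain ⟨u', hu'⟩ : ∃ f : ℝ → ℝ, f = fun x =>
    k * θ2m * exp (θ2m * (x - 0)) + -k * -θ1m * exp (-θ1m * (x - 0)) := ⟨_, rfl⟩
  obtain ⟨v', hv'⟩ : ∃ f : ℝ → ℝ, f = fun x =>
    A * θ2p * exp (θ2p * (x - a)) + B * -θ1p * exp (-θ1p * (x - a)) := ⟨_, rfl⟩
  have e1 : ∀ x, exp (θ2m * (x - a)) = exp (θ2m * (0 - a)) * exp (θ2m * (x - 0)) := fun x => by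
    rw [← exp_add]; ring_nf
  have e2 : ∀ x, exp (-θ1m * (x - a)) = exp (-θ1m * (0 - a)) * exp (-θ1m * (x - 0)) := fun x => by
    rw [← exp_add]; ring_nf
  have hgu : g = fun x => if a < x then v x else u x := by
    funext x
    rw [hg, hgp x, hgm x]
    split_ifs with h
    · simp only [hv, hA, hB]; ring
    · rw [e1 x, e2 x, hgm0, hgp0]; simp only [hu, hk]; ring
  have f1 := e1 a
  have f2 := e2 a
  rw [sub_self, mul_zero, exp_zero] at f1 f2
  have hua : u a = gm 0 - gp 0 := by
    simp only [hu, hk, hgm0, hgp0]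
    linear_combination (1 - cm) * (exp (θ2m * (0 - a)) * f2 - exp (-θ1m * (0 - a)) * f1)
  have hu'a : u' a = θ2m * gm 0 + θ1p * gp 0 := by
    simp only [hu', hk, hgm0, hgp0]
    linear_combination (1 - cm) * (-θ1m * exp (θ2m * (0 - a)) * f2
      - θ2m * exp (-θ1m * (0 - a)) * f1) - exp (θ2m * (0 - a)) * hcm1
  have hglue : u a = v a := by rw [hua]; simp only [hv, sub_self, mul_zero, exp_zero, hA, hB]; ring
  have hglue' : u' a = v' a := by
    rw [hu'a]
    simp only [hv', sub_self, mul_zero, exp_zero, hA, hB]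
    linear_combination gm 0 * hcp1
  obtain ⟨G, hd, hcG, hG, hG0, K, hK⟩ := exists_deriv_of_glued_exp ha hk0 ht₁ ht hs₁ hs
    hu hu' hv hv' hglue hglue' hgu
  have hg0 : g 0 = 0 := by rw [hg]; ring
  have hpos : ∀ x, 0 ≤ x → 0 < G x := fun x hx =>
    hG0.trans_le (hG.monotoneOn self_mem_Ici (mem_Ici.2 hx) hx)
  obtain ⟨z, hβz, hz, huniq, hmax⟩ :=
    exists_unique_maximizer hβ hd hcG hG hG0 hg0 hK
  have hderiv : deriv g = G := funext fun x => (hd x).deriv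
  have hψ0 : ∀ w, 0 < w → (ψ 0 w = β ↔ G w * (w - β) = g w) := fun w hw => by
    have hGw := hpos w hw.le
    have hint : ∫ s in (0 : ℝ)..w, G s = g w - g 0 :=
      intervalIntegral.integral_eq_sub_of_hasDerivAt (fun x _ => hd x)
        (hcG.intervalIntegrable _ _)
    rw [hψ, hderiv, intervalIntegral.integral_sub (by simp)
      ((hcG.div_const _).intervalIntegrable _ _), intervalIntegral.integral_div, hint, hg0]
    simp only [intervalIntegral.integral_const, smul_eq_mul, mul_one, sub_zero]
    rw [sub_eq_iff_eq_add, ← sub_eq_iff_eq_add', eq_div_iff hGw.ne', mul_comm]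
  refine ⟨z, hβ.trans hβz, (hψ0 z (hβ.trans hβz)).2 hz,
    fun w hw h => huniq w hw ((hψ0 w hw).1 h), ?_⟩
  have hzD : ((0 : ℝ), z) ∈ Dζ := by
    rw [hD]; exact ⟨le_rfl, (hβ.trans hβz).le, by simpa using hβz.le⟩
  rw [hM]
  refine Subset.antisymm (fun p hp => ?_) (singleton_subset_iff.2 ⟨hzD, fun p hp => ?_⟩)
  · by_contra hne
    have h1 := hp.1
    rw [hD] at h1
    have h2 := hp.2 _ hzD
    rw [hζ, hζ] at h2
    exact (hmax p.1 p.2 h1.1 h1.2.2 hne).not_ge h2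
  · by_cases hne : p = (0, z)
    · rw [hne]
    · rw [hD] at hp
      rw [hζ, hζ]
      exact (hmax p.1 p.2 hp.1 hp.2.2 hne).le
end
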